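/- arXiv:1605.05441 — 4 statements merged into one kernel-verified Lean document; each statement's English description precedes it below -/
import Mathlib

section
/- Suppose there exist constants c, C > 0 and κ ≥ 0 such that the eigenvalues λ_i² of A satisfy c i^κ ≤ λ_i ≤ C i^κ for i = 1,…,d, that φ_d satisfies Assumption 1, and that r = max{s, s', s''} satisfies Assumption 2. If h = l² d^{−1/3−2κ} for some l > 0, then for every fixed L ∈ ℕ the L-step SLA Metropolis–Hastings algorithm, in equilibrium (x ~ π_d), satisfies E[α(x,y)] → 2Φ(−l³√(Lτ)/8) as d → ∞, and for q_i a normalized eigenvector of A, E[(q_i^T(x' − x))²] = 2LhΦ(−l³√(Lτ)/8) + o(h) as d → ∞, where τ = lim_{d→∞} d^{−1−6κ} Σ_{i=1}^d λ_i^6. -/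
open MeasureTheory ProbabilityTheory Matrix Filter Asymptotics
open scoped Topology

noncomputable section LStepSetup

/-- The standard Gaussian measure `N(0, I)` on `ℝ^d`. -/
def stdGaussian (d : ℕ) : Measure (Fin d → ℝ) := Measure.pi fun _ => gaussianReal 0 1

/-- Product measure carrying the two independent standard Gaussian inputs. -/
def prodGaussian (d : ℕ) : Measure ((Fin d → ℝ) × (Fin d → ℝ)) :=
  (stdGaussian d).prod (stdGaussian d)

/-- Standard normal cumulative distribution function `Φ`. -/
def Phi (x : ℝ) : ℝ := (gaussianReal 0 1 (Set.Iic x)).toReal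

/-- Fractional power `A^s = Q diag(λ_i^{2s}) Qᵀ`. -/
def Apow {d : ℕ} (Q : Matrix (Fin d) (Fin d) ℝ) (lam : Fin d → ℝ) (s : ℝ) :
    Matrix (Fin d) (Fin d) ℝ :=
  Q * Matrix.diagonal (fun i => lam i ^ (2 * s)) * Qᵀ

/-- The norm `|v|_s = |A^s v|` (Euclidean norm). -/
def snorm {d : ℕ} (Q : Matrix (Fin d) (Fin d) ℝ) (lam : Fin d → ℝ) (s : ℝ)
    (v : Fin d → ℝ) : ℝ :=
  Real.sqrt ((Apow Q lam s).mulVec v ⬝ᵥ (Apow Q lam s).mulVec v)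

/-- The equilibrium reference state `x = A⁻¹b + Rξ` with `R Rᵀ = A⁻¹`. -/
def xeq {d : ℕ} (A : Matrix (Fin d) (Fin d) ℝ) (b : Fin d → ℝ)
    (R : Matrix (Fin d) (Fin d) ℝ) (ξ : Fin d → ℝ) : Fin d → ℝ :=
  A⁻¹.mulVec b + R.mulVec ξ

/-- The SLA iteration matrix `G = I - (h/2)A`. -/
def Gsla {d : ℕ} (A : Matrix (Fin d) (Fin d) ℝ) (h : ℝ) : Matrix (Fin d) (Fin d) ℝ :=
  1 - (h / 2) • A

/-- Mean of the `L`-step SLA proposal: `G^L x + (I-G)⁻¹(I-G^L)(h/2)b`. -/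
def lsMean {d : ℕ} (A : Matrix (Fin d) (Fin d) ℝ) (b : Fin d → ℝ) (h : ℝ) (L : ℕ)
    (u : Fin d → ℝ) : Fin d → ℝ :=
  (Gsla A h ^ L).mulVec u
    + ((1 - Gsla A h)⁻¹ * (1 - Gsla A h ^ L)).mulVec ((h / 2) • b)

/-- Covariance of the `L`-step SLA proposal: `Σ_L = Σ_{l=0}^{L-1} h G^{2l}`. -/
def lsCov {d : ℕ} (A : Matrix (Fin d) (Fin d) ℝ) (h : ℝ) (L : ℕ) :
    Matrix (Fin d) (Fin d) ℝ :=
  ∑ l ∈ Finset.range L, h • Gsla A h ^ (2 * l)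

/-- The `L`-step SLA proposal `y = G^L x + (I-G)⁻¹(I-G^L)(h/2)b + ν_L` with
`ν_L = CL η`, `CL CLᵀ = Σ_L`, `η ~ N(0, I)`. -/
def ylstep {d : ℕ} (A : Matrix (Fin d) (Fin d) ℝ) (b : Fin d → ℝ) (h : ℝ) (L : ℕ)
    (CL : Matrix (Fin d) (Fin d) ℝ) (x η : Fin d → ℝ) : Fin d → ℝ :=
  lsMean A b h L x + CL.mulVec η

/-- Log `L`-step proposal density (up to the normalising constant):
`log q_L(u,w) = -½(w - mean(u))ᵀ Σ_L⁻¹ (w - mean(u))`. -/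
def lsQlog {d : ℕ} (A : Matrix (Fin d) (Fin d) ℝ) (b : Fin d → ℝ) (h : ℝ) (L : ℕ)
    (u w : Fin d → ℝ) : ℝ :=
  -(1/2) * ((w - lsMean A b h L u) ⬝ᵥ (lsCov A h L)⁻¹.mulVec (w - lsMean A b h L u))

/-- Log target density (up to the normalising constant):
`log π_d(z) = -½zᵀAz + bᵀz - φ_d(z)`. -/
def lsPlog {d : ℕ} (A : Matrix (Fin d) (Fin d) ℝ) (b : Fin d → ℝ)
    (φ : (Fin d → ℝ) → ℝ) (z : Fin d → ℝ) : ℝ :=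
  -(1/2) * (z ⬝ᵥ A.mulVec z) + b ⬝ᵥ z - φ z

/-- Metropolis–Hastings acceptance probability for the `L`-step proposal:
`α(x,y) = 1 ∧ (π_d(y)q_L(y,x))/(π_d(x)q_L(x,y))`. -/
def lsAccept {d : ℕ} (A : Matrix (Fin d) (Fin d) ℝ) (b : Fin d → ℝ)
    (φ : (Fin d → ℝ) → ℝ) (h : ℝ) (L : ℕ) (x y : Fin d → ℝ) : ℝ :=
  min 1 (Real.exp (lsPlog A b φ y - lsPlog A b φ x
    + lsQlog A b h L y x - lsQlog A b h L x y))

end LStepSetup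

instance isProbabilityMeasure_stdGaussian_fin (d : ℕ) :
    IsProbabilityMeasure (stdGaussian d) := by
  unfold _root_.stdGaussian; infer_instance

instance isProbabilityMeasure_prodGaussian (d : ℕ) :
    IsProbabilityMeasure (prodGaussian d) := by
  unfold prodGaussian; infer_instance

lemma charFunDual_gaussianReal_zero_one (T : StrongDual ℝ ℝ) :
    charFunDual (gaussianReal 0 1) T = Complex.exp (-((T 1 ^ 2 : ℝ) : ℂ) / 2) := by
  have hT : ∀ x : ℝ, T x = x * T 1 := fun x => by
    have := T.map_smul x 1
    simpa only [smul_eq_mul, mul_one] using this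
  have : charFunDual (gaussianReal 0 1) T = charFun (gaussianReal 0 1) (T 1) := by
    rw [charFunDual_apply, charFun_apply_real]
    congr 1
    ext x
    rw [hT x]
    push_cast
    ring_nf
  rw [this, charFun_gaussianReal]
  congr 1
  push_cast
  ring

/-- The law of `Mξ` for a standard Gaussian vector `ξ` depends only on `M Mᵀ`. -/
lemma stdGaussian_map_mulVec_eq {d d' n : ℕ} (M : Matrix (Fin n) (Fin d) ℝ)
    (N : Matrix (Fin n) (Fin d') ℝ) (h : M * Mᵀ = N * Nᵀ) :
    (stdGaussian d).map (fun v => M *ᵥ v) = (stdGaussian d').map (fun v => N *ᵥ v) := by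
  have key : ∀ {e : ℕ} (P : Matrix (Fin n) (Fin e) ℝ) (T : StrongDual ℝ (Fin n → ℝ)),
      charFunDual ((stdGaussian e).map (fun v => P *ᵥ v)) T
        = Complex.exp (-((((fun i => T (Pi.single i 1)) ⬝ᵥ
            (P * Pᵀ) *ᵥ (fun i => T (Pi.single i 1)) : ℝ)) : ℂ) / 2) := by
    intro e P T
    have hc : (fun v => P *ᵥ v) = ⇑(LinearMap.toContinuousLinearMap (Matrix.mulVecLin P)) := by
      ext v; simp
    rw [hc, charFunDual_map]
    unfold _root_.stdGaussian
    rw [charFunDual_pi]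
    simp_rw [charFunDual_gaussianReal_zero_one]
    rw [← Complex.exp_sum]
    congr 1
    rw [← Finset.sum_div, Finset.sum_neg_distrib]
    congr 2
    norm_cast
    rw [← mulVec_mulVec, dotProduct_mulVec, ← mulVec_transpose]
    refine Finset.sum_congr rfl fun j _ => ?_
    have hT : T (P *ᵥ Pi.single j 1) = (Pᵀ *ᵥ fun i => T (Pi.single i 1)) j := by
      have h1 := T.toLinearMap.pi_apply_eq_sum_univ (P *ᵥ Pi.single j 1)
      simp only [ContinuousLinearMap.coe_coe, mulVec_single_one, col_apply, smul_eq_mul] at h1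
      rw [mulVec_single_one, h1, mulVec, dotProduct]
      refine Finset.sum_congr rfl fun i _ => ?_
      simp only [transpose_apply]
      congr 2
      ext k
      simp [Pi.single_apply, eq_comm]
    rw [← hT]
    simp [pow_two]
  refine Measure.ext_of_charFunDual ?_
  ext T
  rw [key, key, h]

section Moments

variable {Ω : Type*} [MeasurableSpace Ω] {μ : Measure Ω}

lemma integral_abs_le_sqrt_integral_sq [IsProbabilityMeasure μ] {X : Ω → ℝ} (hX : MemLp X 2 μ) :
    ∫ ω, |X ω| ∂μ ≤ √(∫ ω, X ω ^ 2 ∂μ) := by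
  apply Real.le_sqrt_of_sq_le
  have h1 := variance_nonneg (fun ω => |X ω|) μ
  rw [variance_eq_sub (X := fun ω => |X ω|) hX.abs] at h1
  simp only [Pi.pow_apply, sq_abs] at h1
  linarith

lemma integral_mul_le_sqrt_mul_sqrt {X Y : Ω → ℝ} (hX0 : 0 ≤ X) (hY0 : 0 ≤ Y)
    (hX : MemLp X 2 μ) (hY : MemLp Y 2 μ) :
    ∫ ω, X ω * Y ω ∂μ ≤ √(∫ ω, X ω ^ 2 ∂μ) * √(∫ ω, Y ω ^ 2 ∂μ) := by
  have := integral_mul_le_Lp_mul_Lq_of_nonneg (μ := μ) Real.HolderConjugate.two_two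
    (ae_of_all _ hX0) (ae_of_all _ hY0) (by simpa using hX) (by simpa using hY)
  simpa [Real.sqrt_eq_rpow] using this

end Moments

lemma integral_sq_sum_stdGaussian {d : ℕ} {X : Fin d → ℝ → ℝ}
    (hX : ∀ i, MemLp (X i) 2 (gaussianReal 0 1)) (h0 : ∀ i, ∫ t, X i t ∂gaussianReal 0 1 = 0) :
    MemLp (fun w : Fin d → ℝ => ∑ i, X i (w i)) 2 (stdGaussian d) ∧
    ∫ w, (∑ i, X i (w i)) ^ 2 ∂stdGaussian d = ∑ i, ∫ t, X i t ^ 2 ∂gaussianReal 0 1 := by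
  have hmp : ∀ i : Fin d, MeasurePreserving (Function.eval i) (stdGaussian d)
      (gaussianReal 0 1) := fun i => by
    unfold _root_.stdGaussian
    exact measurePreserving_eval _ i
  have hL : ∀ i, MemLp (fun w : Fin d → ℝ => X i (w i)) 2 (stdGaussian d) := fun i =>
    (hX i).comp_measurePreserving (hmp i)
  have hI : ∀ i, ∫ w, X i (w i) ∂stdGaussian d = 0 := fun i => by
    rw [← h0 i, ← (hmp i).map_eq, integral_map (hmp i).aemeasurable
      (by rw [(hmp i).map_eq]; exact (hX i).1)]
  have hS : MemLp (fun w : Fin d → ℝ => ∑ i, X i (w i)) 2 (stdGaussian d) :=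
    memLp_finsetSum _ fun i _ => hL i
  refine ⟨hS, ?_⟩
  have h2 : ∫ w, (∑ i, X i (w i)) ∂stdGaussian d = 0 := by
    rw [integral_finsetSum _ fun i _ => (hL i).integrable (by norm_num)]
    simp [hI]
  have h3 := variance_of_integral_eq_zero hS.1.aemeasurable h2
  have h4 := variance_sum_pi (μ := fun _ : Fin d => gaussianReal 0 1) hX
  rw [← h3, Finset.sum_congr rfl fun i _ =>
    (variance_of_integral_eq_zero (hX i).1.aemeasurable (h0 i)).symm, ← h4]
  congr 1
  ext w
  simp

lemma integrable_abs_pow_gaussianReal (n : ℕ) :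
    Integrable (fun t : ℝ => |t| ^ n) (gaussianReal 0 1) := by
  simpa using (memLp_id_gaussianReal (μ := 0) (v := 1) n).integrable_norm_pow'

lemma integrable_pow_gaussianReal (n : ℕ) :
    Integrable (fun t : ℝ => t ^ n) (gaussianReal 0 1) := by
  refine (integrable_abs_pow_gaussianReal n).mono' (by fun_prop) (ae_of_all _ fun t => ?_)
  simp

lemma integral_sq_gaussianReal : ∫ t, t ^ 2 ∂gaussianReal 0 1 = 1 := by
  have := variance_of_integral_eq_zero (X := fun t : ℝ => t) (μ := gaussianReal 0 1)
    (by fun_prop) (by simp)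
  simpa using this.symm

lemma memLp_two_mul_gaussianReal (a : ℝ) :
    MemLp (fun t : ℝ => a * t) 2 (gaussianReal 0 1) := by
  rw [memLp_two_iff_integrable_sq (by fun_prop)]
  simp_rw [mul_pow]
  exact (integrable_pow_gaussianReal 2).const_mul _

lemma memLp_two_mul_sq_sub_one_gaussianReal (a : ℝ) :
    MemLp (fun t : ℝ => a * (t ^ 2 - 1)) 2 (gaussianReal 0 1) := by
  rw [memLp_two_iff_integrable_sq (by fun_prop)]
  have : (fun t : ℝ => (a * (t ^ 2 - 1)) ^ 2)
      = fun t => a ^ 2 * (t ^ 4 - 2 * t ^ 2 + 1) := by ext t; ring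
  rw [this]
  exact (((integrable_pow_gaussianReal 4).sub ((integrable_pow_gaussianReal 2).const_mul 2)).add
    (integrable_const 1)).const_mul _

lemma memLp_dotProduct_stdGaussian {d : ℕ} (a : Fin d → ℝ) :
    MemLp (fun w => a ⬝ᵥ w) 2 (stdGaussian d) :=
  (integral_sq_sum_stdGaussian (fun i => memLp_two_mul_gaussianReal (a i))
    (fun i => by rw [integral_const_mul]; simp)).1

lemma integral_dotProduct_sq_stdGaussian {d : ℕ} (a : Fin d → ℝ) :
    ∫ w, (a ⬝ᵥ w) ^ 2 ∂stdGaussian d = ∑ i, a i ^ 2 := by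
  have := (integral_sq_sum_stdGaussian (fun i => memLp_two_mul_gaussianReal (a i))
    (fun i => by rw [integral_const_mul]; simp)).2
  simp_rw [mul_pow, integral_const_mul, integral_sq_gaussianReal, mul_one] at this
  exact this

lemma integral_sq_sub_one_gaussianReal (a : ℝ) :
    ∫ t, a * (t ^ 2 - 1) ∂gaussianReal 0 1 = 0 := by
  rw [integral_const_mul, integral_sub (integrable_pow_gaussianReal 2) (integrable_const 1),
    integral_sq_gaussianReal]
  simp

lemma memLp_sum_mul_sq_sub_one_stdGaussian {d : ℕ} (u : Fin d → ℝ) :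
    MemLp (fun w : Fin d → ℝ => ∑ i, u i * (w i ^ 2 - 1)) 2 (stdGaussian d) :=
  (integral_sq_sum_stdGaussian (fun i => memLp_two_mul_sq_sub_one_gaussianReal (u i))
    (fun i => integral_sq_sub_one_gaussianReal (u i))).1

lemma integral_abs_sum_mul_sq_sub_one_le {d : ℕ} (u : Fin d → ℝ) :
    ∫ w, |∑ i, u i * (w i ^ 2 - 1)| ∂stdGaussian d
      ≤ √((∫ t, (t ^ 2 - 1) ^ 2 ∂gaussianReal 0 1) * ∑ i, u i ^ 2) := by
  refine (integral_abs_le_sqrt_integral_sq (memLp_sum_mul_sq_sub_one_stdGaussian u)).trans ?_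
  apply Real.sqrt_le_sqrt
  rw [(integral_sq_sum_stdGaussian (fun i => memLp_two_mul_sq_sub_one_gaussianReal (u i))
    (fun i => integral_sq_sub_one_gaussianReal (u i))).2]
  simp_rw [mul_pow, integral_const_mul]
  rw [← Finset.sum_mul, mul_comm]

lemma integrable_coord_sq_stdGaussian {d : ℕ} (i : Fin d) :
    Integrable (fun w : Fin d → ℝ => w i ^ 2) (stdGaussian d) := by
  have := (memLp_dotProduct_stdGaussian (Pi.single i (1 : ℝ))).integrable_sq
  simpa using this

lemma integral_coord_sq_stdGaussian {d : ℕ} (i : Fin d) :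
    ∫ w, w i ^ 2 ∂stdGaussian d = 1 := by
  have := integral_dotProduct_sq_stdGaussian (Pi.single i (1 : ℝ))
  simpa [Pi.single_apply] using this

/-- Joint law of two linear functionals of a standard Gaussian vector. -/
lemma stdGaussian_map_pair {d : ℕ} (a v : Fin d → ℝ) (ha : a ⬝ᵥ a = 1) :
    (stdGaussian d).map (fun w => (a ⬝ᵥ w, v ⬝ᵥ w))
      = ((gaussianReal 0 1).prod (gaussianReal 0 1)).map
        (fun p => (p.1, (a ⬝ᵥ v) * p.1 + √(v ⬝ᵥ v - (a ⬝ᵥ v) ^ 2) * p.2)) := by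
  have hcs : 0 ≤ v ⬝ᵥ v - (a ⬝ᵥ v) ^ 2 := by
    have := Finset.sum_nonneg (s := Finset.univ) fun i _ => sq_nonneg (v i - (a ⬝ᵥ v) * a i)
    have h2 : ∑ i, (v i - (a ⬝ᵥ v) * a i) ^ 2
        = v ⬝ᵥ v - 2 * (a ⬝ᵥ v) * (a ⬝ᵥ v) + (a ⬝ᵥ v) ^ 2 * (a ⬝ᵥ a) := by
      generalize hq : a ⬝ᵥ v = q
      rw [show 2 * q * q = 2 * q * (a ⬝ᵥ v) by rw [hq]]
      simp only [dotProduct, Finset.mul_sum, ← Finset.sum_sub_distrib, ← Finset.sum_add_distrib]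
      exact Finset.sum_congr rfl fun i _ => by ring
    rw [h2, ha] at this
    linarith
  have h := stdGaussian_map_mulVec_eq (Matrix.of ![a, v])
    !![1, 0; a ⬝ᵥ v, √(v ⬝ᵥ v - (a ⬝ᵥ v) ^ 2)] (by
      ext i j
      have hl : (Matrix.of ![a, v] * (Matrix.of ![a, v])ᵀ) i j = ![a, v] i ⬝ᵥ ![a, v] j := rfl
      rw [hl, mul_apply, Fin.sum_univ_two]
      fin_cases i <;> fin_cases j
      · simpa using ha
      · simp
      · simp [dotProduct_comm]
      · simp [Real.mul_self_sqrt hcs, ← pow_two])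
  have hg : Measurable (fun u : Fin 2 → ℝ => (u 0, u 1)) := by fun_prop
  have h1 := congrArg (Measure.map (fun u : Fin 2 → ℝ => (u 0, u 1))) h
  have e2 : (gaussianReal 0 1).prod (gaussianReal 0 1)
      = (stdGaussian 2).map (fun u : Fin 2 → ℝ => (u 0, u 1)) :=
    (measurePreserving_finTwoArrow (gaussianReal 0 1)).map_eq.symm
  rw [Measure.map_map hg (by fun_prop), Measure.map_map hg (by fun_prop)] at h1
  rw [e2, Measure.map_map (by fun_prop) hg]
  convert h1 using 2
  · ext u <;> simp
  · ext u <;> simp [dotProduct]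

/-- Metropolis acceptance function in terms of the log ratio. -/
noncomputable def metro (t : ℝ) : ℝ := min 1 (Real.exp t)

lemma metro_nonneg (t : ℝ) : 0 ≤ metro t := le_min zero_le_one (Real.exp_pos t).le

lemma metro_le_one (t : ℝ) : metro t ≤ 1 := min_le_left _ _

lemma abs_metro_le_one (t : ℝ) : |metro t| ≤ 1 := by
  rw [abs_of_nonneg (metro_nonneg t)]; exact metro_le_one t

lemma continuous_metro : Continuous metro := by
  unfold metro; fun_prop

attribute [fun_prop] continuous_metro

@[fun_prop]
lemma measurable_metro : Measurable metro := continuous_metro.measurable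

lemma metro_sub_le {s t : ℝ} (h : s ≤ t) : metro t - metro s ≤ t - s := by
  unfold metro
  rcases le_total 0 s with hs | hs
  · rw [min_eq_left (Real.one_le_exp hs), min_eq_left (Real.one_le_exp (hs.trans h))]
    linarith
  · rw [min_eq_right (Real.exp_le_one_iff.2 hs)]
    rcases le_total 0 t with ht | ht
    · rw [min_eq_left (Real.one_le_exp ht)]
      have := Real.add_one_le_exp s
      linarith
    · rw [min_eq_right (Real.exp_le_one_iff.2 ht)]
      have h1 := Real.add_one_le_exp (s - t)
      have h2 : Real.exp s = Real.exp t * Real.exp (s - t) := by rw [← Real.exp_add]; ring_nf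
      have h3 := Real.exp_le_one_iff.2 ht
      have h4 := Real.exp_pos t
      nlinarith [mul_le_mul_of_nonneg_left h1 h4.le, mul_le_mul_of_nonneg_right h3 (sub_nonneg.2 h)]

lemma abs_metro_sub_le (s t : ℝ) : |metro s - metro t| ≤ |s - t| := by
  have mono : Monotone metro := fun a b h => min_le_min_left _ (Real.exp_le_exp.2 h)
  rcases le_total s t with h | h
  · rw [abs_sub_comm, abs_sub_comm s, abs_of_nonneg (sub_nonneg.2 (mono h)),
      abs_of_nonneg (sub_nonneg.2 h)]
    exact metro_sub_le h
  · rw [abs_of_nonneg (sub_nonneg.2 (mono h)), abs_of_nonneg (sub_nonneg.2 h)]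
    exact metro_sub_le h

lemma abs_metro_sub_le_min (s t : ℝ) : |metro s - metro t| ≤ min 1 |s - t| := by
  refine le_min ?_ (abs_metro_sub_le s t)
  rw [abs_le]
  constructor <;> linarith [metro_nonneg s, metro_nonneg t, metro_le_one s, metro_le_one t]

lemma integral_metro_gaussianReal {σ : ℝ} (hσ : 0 ≤ σ) :
    ∫ t, metro (-(σ ^ 2) / 2 + σ * t) ∂gaussianReal 0 1 = 2 * Phi (-σ / 2) := by
  have e : ∀ t, metro (-(σ ^ 2) / 2 + σ * t) = (Set.Ici (σ / 2)).indicator (fun _ => (1 : ℝ)) t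
      + (Set.Iio (σ / 2)).indicator (fun t => Real.exp (-(σ ^ 2) / 2 + σ * t)) t := by
    intro t
    unfold metro
    rcases le_or_gt (σ / 2) t with h | h
    · rw [Set.indicator_of_mem (Set.mem_Ici.2 h), Set.indicator_of_notMem (by simpa using h),
        add_zero, min_eq_left]
      exact Real.one_le_exp (by nlinarith)
    · rw [Set.indicator_of_notMem (by simpa using h), Set.indicator_of_mem (Set.mem_Iio.2 h),
        zero_add, min_eq_right]
      exact Real.exp_le_one_iff.2 (by nlinarith)
  simp_rw [e]
  have i1 : Integrable ((Set.Ici (σ / 2)).indicator (fun _ => (1 : ℝ))) (gaussianReal 0 1) :=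
    (integrable_const 1).indicator measurableSet_Ici
  have i2 : Integrable ((Set.Iio (σ / 2)).indicator
      (fun t => Real.exp (-(σ ^ 2) / 2 + σ * t))) (gaussianReal 0 1) := by
    refine Integrable.indicator ?_ measurableSet_Iio
    simp_rw [Real.exp_add]
    exact (integrable_exp_mul_gaussianReal σ).const_mul _
  rw [integral_add i1 i2, integral_indicator measurableSet_Ici]
  have h1 : ∫ t in Set.Ici (σ / 2), (1 : ℝ) ∂gaussianReal 0 1 = Phi (-σ / 2) := by
    have : (gaussianReal 0 1) (Set.Ici (σ / 2)) = (gaussianReal 0 1) (Set.Iic (-σ / 2)) := by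
      have h := gaussianReal_map_neg (μ := 0) (v := 1)
      rw [neg_zero] at h
      conv_rhs => rw [← h]
      rw [Measure.map_apply measurable_neg measurableSet_Iic]
      congr 1
      ext t
      simp only [Set.mem_Ici, Set.mem_preimage, Set.mem_Iic]
      constructor <;> intro _ <;> linarith
    rw [setIntegral_const, smul_eq_mul, mul_one, Measure.real, this, Phi]
  have h2 : ∫ t, (Set.Iio (σ / 2)).indicator (fun t => Real.exp (-(σ ^ 2) / 2 + σ * t)) t
      ∂gaussianReal 0 1 = Phi (-σ / 2) := by
    have hpdf : ∀ t, gaussianPDFReal 0 1 t • (Set.Iio (σ / 2)).indicator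
        (fun t => Real.exp (-(σ ^ 2) / 2 + σ * t)) t
        = gaussianPDFReal σ 1 t • (Set.Iio (σ / 2)).indicator (fun _ => (1 : ℝ)) t := by
      intro t
      by_cases ht : t ∈ Set.Iio (σ / 2)
      · rw [Set.indicator_of_mem ht, Set.indicator_of_mem ht]
        simp only [gaussianPDFReal, smul_eq_mul, mul_one, NNReal.coe_one]
        rw [mul_assoc, ← Real.exp_add]
        congr 2
        ring
      · rw [Set.indicator_of_notMem ht, Set.indicator_of_notMem ht]; simp
    rw [integral_gaussianReal_eq_integral_smul one_ne_zero]
    simp_rw [hpdf]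
    rw [← integral_gaussianReal_eq_integral_smul one_ne_zero, integral_indicator measurableSet_Iio,
      setIntegral_const, smul_eq_mul, mul_one, Measure.real, Phi]
    congr 1
    have h := gaussianReal_map_add_const (μ := 0) (v := 1) σ
    rw [zero_add] at h
    rw [← h, Measure.map_apply (by fun_prop) measurableSet_Iio]
    have := nullSingletonClass_gaussianReal (μ := 0) (v := 1) one_ne_zero
    rw [← measure_congr (Iio_ae_eq_Iic)]
    congr 1
    ext t
    simp only [Set.mem_Iio, Set.mem_preimage]
    constructor <;> intro _ <;> linarith
  rw [h1, h2]
  ring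

lemma sqrt_add_le_sqrt_add_sqrt {x y : ℝ} (hx : 0 ≤ x) (hy : 0 ≤ y) :
    √(x + y) ≤ √x + √y := by
  rw [Real.sqrt_le_left (by positivity)]
  nlinarith [Real.sq_sqrt hx, Real.sq_sqrt hy,
    mul_nonneg (Real.sqrt_nonneg x) (Real.sqrt_nonneg y)]

lemma abs_sqrt_sub_le (x : ℝ) {σ : ℝ} (hσ : 0 ≤ σ) : |√x - σ| ≤ √|x - σ ^ 2| := by
  apply Real.le_sqrt_of_sq_le
  rw [sq_abs]
  rcases le_total 0 x with hx | hx
  · have h := Real.sqrt_nonneg x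
    have e : x - σ ^ 2 = (√x - σ) * (√x + σ) := by nlinarith [Real.sq_sqrt hx]
    rw [e, abs_mul, ← sq_abs, pow_two]
    refine mul_le_mul_of_nonneg_left ?_ (abs_nonneg _)
    rw [abs_of_nonneg (add_nonneg h hσ), abs_le]
    constructor <;> linarith
  · rw [Real.sqrt_eq_zero_of_nonpos hx, abs_of_nonpos (by nlinarith)]
    nlinarith

lemma measurePreserving_dotProduct_stdGaussian {d : ℕ} (a : Fin d → ℝ) (ha : a ⬝ᵥ a = 1) :
    MeasurePreserving (fun w => a ⬝ᵥ w) (stdGaussian d) (gaussianReal 0 1) := by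
  refine ⟨by fun_prop, ?_⟩
  have h := congrArg (Measure.map Prod.fst) (stdGaussian_map_pair a a ha)
  rw [Measure.map_map measurable_fst (by fun_prop), Measure.map_map measurable_fst (by fun_prop)]
    at h
  have h2 : (Prod.fst ∘ fun p : ℝ × ℝ => (p.1, (a ⬝ᵥ a) * p.1 + √(a ⬝ᵥ a - (a ⬝ᵥ a) ^ 2) * p.2))
      = Prod.fst := rfl
  rw [h2, Measure.map_fst_prod, measure_univ, one_smul] at h
  exact h

section Weight

variable {k : ℝ → ℝ}

lemma integrable_weight (hk : Measurable k) (hk1 : ∀ t, |k t| ≤ 1 + t ^ 2) :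
    Integrable k (gaussianReal 0 1) :=
  ((integrable_const 1).add (integrable_pow_gaussianReal 2)).mono' hk.aestronglyMeasurable
    (ae_of_all _ fun t => by simpa using hk1 t)

lemma integrable_one_add_sq_sq : Integrable (fun t : ℝ => (1 + t ^ 2) ^ 2) (gaussianReal 0 1) := by
  have : (fun t : ℝ => (1 + t ^ 2) ^ 2) = fun t => 1 + 2 * t ^ 2 + t ^ 4 := by ext t; ring
  rw [this]
  exact ((integrable_const 1).add ((integrable_pow_gaussianReal 2).const_mul 2)).add
    (integrable_pow_gaussianReal 4)

lemma integrable_one_add_sq_mul_abs :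
    Integrable (fun t : ℝ => (1 + t ^ 2) * |t|) (gaussianReal 0 1) := by
  have : (fun t : ℝ => (1 + t ^ 2) * |t|) = fun t => |t| ^ 1 + |t| ^ 3 := by
    ext t; rw [← sq_abs t]; ring
  rw [this]
  exact (integrable_abs_pow_gaussianReal 1).add (integrable_abs_pow_gaussianReal 3)

/-- Constant controlling the dependence between a weight and the log acceptance ratio. -/
noncomputable def weightConst : ℝ :=
  ∫ t, (1 + t ^ 2) * |t| ∂gaussianReal 0 1 + 2 * ∫ t, |t| ∂gaussianReal 0 1

lemma weightConst_nonneg : 0 ≤ weightConst := by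
  unfold weightConst
  positivity

lemma abs_integral_weight_mul_metro_sub_le (hk : Measurable k) (hk1 : ∀ t, |k t| ≤ 1 + t ^ 2)
    {d : ℕ} (a v : Fin d → ℝ) (ha : a ⬝ᵥ a = 1) (M : ℝ) {σ : ℝ} (hσ : 0 ≤ σ) :
    |∫ w, k (a ⬝ᵥ w) * metro (M + v ⬝ᵥ w) ∂stdGaussian d
        - (∫ t, k t ∂gaussianReal 0 1) * ∫ t, metro (M + σ * t) ∂gaussianReal 0 1|
      ≤ weightConst * (|a ⬝ᵥ v| + √|v ⬝ᵥ v - σ ^ 2|) := by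
  set β := √(v ⬝ᵥ v - (a ⬝ᵥ v) ^ 2) with hβ
  set q := a ⬝ᵥ v with hq
  have e1 : ∫ w, k (a ⬝ᵥ w) * metro (M + v ⬝ᵥ w) ∂stdGaussian d
      = ∫ p, k p.1 * metro (M + (q * p.1 + β * p.2))
        ∂((gaussianReal 0 1).prod (gaussianReal 0 1)) := by
    have h := congrArg (fun μ : Measure (ℝ × ℝ) => ∫ p, k p.1 * metro (M + p.2) ∂μ)
      (stdGaussian_map_pair a v ha)
    have hm : Measurable (fun p : ℝ × ℝ => k p.1 * metro (M + p.2)) := by fun_prop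
    rw [integral_map (by fun_prop) hm.aestronglyMeasurable,
      integral_map (by fun_prop) hm.aestronglyMeasurable] at h
    exact h
  have iM : ∀ c : ℝ, Integrable (fun t => metro (M + c * t)) (gaussianReal 0 1) := fun c =>
    (integrable_const (1 : ℝ)).mono' (by fun_prop)
      (ae_of_all _ fun t => by simpa using abs_metro_le_one _)
  have ik := integrable_weight hk hk1
  have i1 : Integrable (fun p : ℝ × ℝ => k p.1 * metro (M + (q * p.1 + β * p.2)))
      ((gaussianReal 0 1).prod (gaussianReal 0 1)) := by
    refine (ik.comp_fst _).norm.mono' (by fun_prop) (ae_of_all _ fun p => ?_)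
    rw [norm_mul]
    exact mul_le_of_le_one_right (norm_nonneg _) (abs_metro_le_one _)
  have i2 : Integrable (fun p : ℝ × ℝ => k p.1 * metro (M + σ * p.2))
      ((gaussianReal 0 1).prod (gaussianReal 0 1)) := ik.mul_prod (iM σ)
  rw [e1, ← integral_prod_mul (μ := gaussianReal 0 1) (ν := gaussianReal 0 1) k
    (fun t => metro (M + σ * t)), ← integral_sub i1 i2]
  have ia : Integrable (fun t : ℝ => |t|) (gaussianReal 0 1) := by
    simpa using integrable_abs_pow_gaussianReal 1
  have i3 : Integrable (fun p : ℝ × ℝ => |q| * ((1 + p.1 ^ 2) * |p.1|))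
      ((gaussianReal 0 1).prod (gaussianReal 0 1)) :=
    (integrable_one_add_sq_mul_abs.comp_fst _).const_mul _
  have i4' : Integrable (fun t : ℝ => 1 + t ^ 2) (gaussianReal 0 1) :=
    (integrable_const 1).add (integrable_pow_gaussianReal 2)
  have i4 : Integrable (fun p : ℝ × ℝ => |β - σ| * ((1 + p.1 ^ 2) * |p.2|))
      ((gaussianReal 0 1).prod (gaussianReal 0 1)) :=
    (i4'.mul_prod ia).const_mul _
  have hβσ : |β - σ| ≤ |q| + √|v ⬝ᵥ v - σ ^ 2| := by
    refine (abs_sqrt_sub_le _ hσ).trans ?_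
    rw [← Real.sqrt_sq_eq_abs q]
    refine le_trans (Real.sqrt_le_sqrt ?_) (sqrt_add_le_sqrt_add_sqrt (sq_nonneg q)
      (abs_nonneg _))
    calc |v ⬝ᵥ v - q ^ 2 - σ ^ 2| = |(v ⬝ᵥ v - σ ^ 2) + (-q ^ 2)| := by congr 1; ring
      _ ≤ |v ⬝ᵥ v - σ ^ 2| + |-q ^ 2| := abs_add_le _ _
      _ = _ := by rw [abs_neg, abs_of_nonneg (sq_nonneg q)]; ring
  calc _ ≤ ∫ p, |k p.1 * metro (M + (q * p.1 + β * p.2)) - k p.1 * metro (M + σ * p.2)|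
        ∂((gaussianReal 0 1).prod (gaussianReal 0 1)) := abs_integral_le_integral_abs
    _ ≤ ∫ p, |q| * ((1 + p.1 ^ 2) * |p.1|) + |β - σ| * ((1 + p.1 ^ 2) * |p.2|)
        ∂((gaussianReal 0 1).prod (gaussianReal 0 1)) := by
      refine integral_mono (i1.sub i2).abs (i3.add i4) fun p => ?_
      rw [← mul_sub, abs_mul]
      have h1 := abs_metro_sub_le (M + (q * p.1 + β * p.2)) (M + σ * p.2)
      have h2 : |M + (q * p.1 + β * p.2) - (M + σ * p.2)| ≤ |q| * |p.1| + |β - σ| * |p.2| := by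
        rw [← abs_mul, ← abs_mul]
        refine le_trans (le_of_eq ?_) (abs_add_le _ _)
        congr 1; ring
      calc _ ≤ (1 + p.1 ^ 2) * (|q| * |p.1| + |β - σ| * |p.2|) :=
            mul_le_mul (hk1 _) (h1.trans h2) (abs_nonneg _) (by positivity)
        _ = _ := by ring
    _ = |q| * ∫ t, (1 + t ^ 2) * |t| ∂gaussianReal 0 1
          + |β - σ| * (2 * ∫ t, |t| ∂gaussianReal 0 1) := by
      rw [integral_add i3 i4, integral_const_mul, integral_const_mul,
        integral_prod_mul (μ := gaussianReal 0 1) (ν := gaussianReal 0 1) (fun t => 1 + t ^ 2)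
          (fun t => |t|), integral_add (integrable_const 1) (integrable_pow_gaussianReal 2),
        integral_sq_gaussianReal, integral_fun_fst (fun t : ℝ => (1 + t ^ 2) * |t|)]
      simp
      norm_num
    _ ≤ _ := by
      unfold weightConst
      have n1 : 0 ≤ ∫ t, (1 + t ^ 2) * |t| ∂gaussianReal 0 1 := by positivity
      have n2 : 0 ≤ ∫ t, |t| ∂gaussianReal 0 1 := by positivity
      have n3 := Real.sqrt_nonneg |v ⬝ᵥ v - σ ^ 2|
      nlinarith [mul_le_mul_of_nonneg_right hβσ n2, mul_nonneg n1 n3]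

end Weight

section Equilibrium

variable {k : ℝ → ℝ} {d : ℕ}

lemma integral_sqrt_le_sqrt_integral {Ω : Type*} [MeasurableSpace Ω] {μ : Measure Ω}
    [IsProbabilityMeasure μ] {X : Ω → ℝ} (hX0 : 0 ≤ X) (hX : Integrable X μ) :
    Integrable (fun ω => √(X ω)) μ ∧ ∫ ω, √(X ω) ∂μ ≤ √(∫ ω, X ω ∂μ) := by
  have hm : AEStronglyMeasurable (fun ω => √(X ω)) μ :=
    Real.continuous_sqrt.comp_aestronglyMeasurable hX.1
  have h2 : MemLp (fun ω => √(X ω)) 2 μ := by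
    rw [memLp_two_iff_integrable_sq hm]
    simpa only [Real.sq_sqrt (hX0 _)] using hX
  refine ⟨h2.integrable (by norm_num), ?_⟩
  have := integral_abs_le_sqrt_integral_sq h2
  simpa only [Real.sq_sqrt (hX0 _), abs_of_nonneg (Real.sqrt_nonneg _)] using this

lemma integrable_weight_dotProduct_snd (hk : Measurable k) (hk1 : ∀ t, |k t| ≤ 1 + t ^ 2)
    {a : Fin d → ℝ} (ha : a ⬝ᵥ a = 1) :
    Integrable (fun ω : (Fin d → ℝ) × (Fin d → ℝ) => k (a ⬝ᵥ ω.2)) (prodGaussian d) :=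
  ((measurePreserving_dotProduct_stdGaussian a ha).integrable_comp_of_integrable
    (integrable_weight hk hk1)).comp_snd _

/-- Limit of the weighted Gaussian acceptance: the weight `k (a ⬝ᵥ w)` and the density `ρ`
decouple from the acceptance probability. -/
lemma abs_integral_weight_metro_density_sub_le (hk : Measurable k) (hk1 : ∀ t, |k t| ≤ 1 + t ^ 2)
    {a : Fin d → ℝ} (ha : a ⬝ᵥ a = 1) (cc : Fin d → ℝ) {ρ : (Fin d → ℝ) → ℝ} {B : ℝ}
    (hρ : Measurable ρ) (hρ0 : ∀ z, 0 ≤ ρ z) (hρB : ∀ z, ρ z ≤ B)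
    (hρ1 : ∫ z, ρ z ∂stdGaussian d = 1) (M : ℝ) {σ : ℝ} (hσ : 0 ≤ σ) :
    |∫ ω, k (a ⬝ᵥ ω.2) * metro (M + ∑ i, cc i * ω.1 i * ω.2 i) * ρ ω.1 ∂prodGaussian d
        - (∫ t, k t ∂gaussianReal 0 1) * ∫ t, metro (M + σ * t) ∂gaussianReal 0 1|
      ≤ B * (weightConst * (√(∑ i, (a i * cc i) ^ 2) + √(|∑ i, cc i ^ 2 - σ ^ 2|
        + √((∫ t, (t ^ 2 - 1) ^ 2 ∂gaussianReal 0 1) * ∑ i, (cc i ^ 2) ^ 2)))) := by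
  set T := (∫ t, k t ∂gaussianReal 0 1) * ∫ t, metro (M + σ * t) ∂gaussianReal 0 1 with hT
  have hB : 0 ≤ B := (hρ0 0).trans (hρB 0)
  have iρ : Integrable ρ (stdGaussian d) := (integrable_const B).mono' (by fun_prop)
    (ae_of_all _ fun z => by simpa [abs_of_nonneg (hρ0 z)] using hρB z)
  have iw := integrable_weight_dotProduct_snd hk hk1 ha
  have i1 : Integrable (fun ω : (Fin d → ℝ) × (Fin d → ℝ) =>
      k (a ⬝ᵥ ω.2) * metro (M + ∑ i, cc i * ω.1 i * ω.2 i) * ρ ω.1) (prodGaussian d) := by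
    refine (iw.norm.mul_const B).mono' (Measurable.aestronglyMeasurable (by fun_prop))
      (ae_of_all _ fun ω => ?_)
    rw [norm_mul, norm_mul]
    refine mul_le_mul (mul_le_of_le_one_right (norm_nonneg _) (abs_metro_le_one _)) ?_
      (norm_nonneg _) (norm_nonneg _)
    simpa [abs_of_nonneg (hρ0 _)] using hρB _
  set I : (Fin d → ℝ) → ℝ := fun z =>
    ∫ w, k (a ⬝ᵥ w) * metro (M + (fun i => cc i * z i) ⬝ᵥ w) ∂stdGaussian d with hI
  have e1 : ∫ ω, k (a ⬝ᵥ ω.2) * metro (M + ∑ i, cc i * ω.1 i * ω.2 i) * ρ ω.1 ∂prodGaussian d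
      = ∫ z, I z * ρ z ∂stdGaussian d := by
    unfold prodGaussian at i1 ⊢
    rw [integral_prod _ i1]
    simp only [integral_mul_const]
    rfl
  have iI : Integrable (fun z => I z * ρ z) (stdGaussian d) := by
    have := i1
    unfold prodGaussian at this
    have h := this.integral_prod_left
    simp only [integral_mul_const] at h
    exact h
  have e2 : T = ∫ z, T * ρ z ∂stdGaussian d := by
    rw [integral_const_mul, hρ1, mul_one]
  have hdev := fun z : Fin d → ℝ =>
    abs_integral_weight_mul_metro_sub_le hk hk1 a (fun i => cc i * z i) ha M hσ
  have s1 : ∀ z : Fin d → ℝ, a ⬝ᵥ (fun i => cc i * z i) = (fun i => a i * cc i) ⬝ᵥ z := fun z => by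
    simp [dotProduct, mul_assoc]
  have s2 : ∀ z : Fin d → ℝ, (fun i => cc i * z i) ⬝ᵥ (fun i => cc i * z i) - σ ^ 2
      = (∑ i, cc i ^ 2 - σ ^ 2) + ∑ i, cc i ^ 2 * (z i ^ 2 - 1) := fun z => by
    simp only [dotProduct, mul_sub, Finset.sum_sub_distrib, mul_one]
    have : ∀ i, cc i * z i * (cc i * z i) = cc i ^ 2 * z i ^ 2 := fun i => by ring
    simp only [this]
    ring
  have j1 := memLp_dotProduct_stdGaussian (fun i => a i * cc i)
  have j2 := memLp_sum_mul_sq_sub_one_stdGaussian (fun i => cc i ^ 2)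
  have j2' : Integrable (fun z : Fin d → ℝ =>
      |(∑ i, cc i ^ 2 - σ ^ 2) + ∑ i, cc i ^ 2 * (z i ^ 2 - 1)|) (stdGaussian d) :=
    ((integrable_const _).add (j2.integrable (by norm_num))).abs
  have j3 := integral_sqrt_le_sqrt_integral (fun z => abs_nonneg _) j2'
  have j1' : Integrable (fun z => |(fun i => a i * cc i) ⬝ᵥ z|) (stdGaussian d) :=
    (j1.integrable (by norm_num)).abs
  rw [e1, e2, ← integral_sub iI (iρ.const_mul T)]
  calc _ ≤ ∫ z, |I z * ρ z - T * ρ z| ∂stdGaussian d := abs_integral_le_integral_abs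
    _ ≤ ∫ z, B * (weightConst * (|(fun i => a i * cc i) ⬝ᵥ z|
          + √|(∑ i, cc i ^ 2 - σ ^ 2) + ∑ i, cc i ^ 2 * (z i ^ 2 - 1)|)) ∂stdGaussian d := by
      refine integral_mono (iI.sub (iρ.const_mul T)).abs
        (((j1'.add j3.1).const_mul _).const_mul _) fun z => ?_
      dsimp only
      rw [← sub_mul, abs_mul, abs_of_nonneg (hρ0 z), mul_comm, ← s1, ← s2]
      exact mul_le_mul (hρB z) (hdev z) (abs_nonneg _) hB
    _ = B * (weightConst * (∫ z, |(fun i => a i * cc i) ⬝ᵥ z| ∂stdGaussian d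
          + ∫ z, √|(∑ i, cc i ^ 2 - σ ^ 2) + ∑ i, cc i ^ 2 * (z i ^ 2 - 1)| ∂stdGaussian d)) := by
      rw [integral_const_mul, integral_const_mul, integral_add j1' j3.1]
    _ ≤ _ := by
      refine mul_le_mul_of_nonneg_left (mul_le_mul_of_nonneg_left (add_le_add ?_ ?_)
        weightConst_nonneg) hB
      · refine (integral_abs_le_sqrt_integral_sq j1).trans ?_
        rw [integral_dotProduct_sq_stdGaussian]
      · refine j3.2.trans (Real.sqrt_le_sqrt ?_)
        refine le_trans ?_ (add_le_add_right (integral_abs_sum_mul_sq_sub_one_le _) _)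
        have hc : |∑ i, cc i ^ 2 - σ ^ 2| = ∫ _ : Fin d → ℝ, |∑ i, cc i ^ 2 - σ ^ 2|
            ∂stdGaussian d := by simp
        have j4 : Integrable (fun z : Fin d → ℝ => |∑ i, cc i ^ 2 * (z i ^ 2 - 1)|)
          (stdGaussian d) := (j2.integrable (by norm_num)).abs
        rw [hc, ← integral_add (integrable_const _) j4]
        exact integral_mono j2' ((integrable_const _).add j4) fun z => abs_add_le _ _

/-- Perturbing the log acceptance ratio by `E` changes the weighted acceptance by an amount
controlled by `min 1 |E|`. -/
lemma abs_integral_weight_metro_perturb_le (hk : Measurable k) (hk1 : ∀ t, |k t| ≤ 1 + t ^ 2)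
    {a : Fin d → ℝ} (ha : a ⬝ᵥ a = 1) {ρ : (Fin d → ℝ) → ℝ} {B : ℝ}
    (hρ : Measurable ρ) (hρ0 : ∀ z, 0 ≤ ρ z) (hρB : ∀ z, ρ z ≤ B)
    {S E : (Fin d → ℝ) × (Fin d → ℝ) → ℝ} (hS : Measurable S) (hE : Measurable E) :
    |∫ ω, k (a ⬝ᵥ ω.2) * metro (S ω + E ω) * ρ ω.1 ∂prodGaussian d
        - ∫ ω, k (a ⬝ᵥ ω.2) * metro (S ω) * ρ ω.1 ∂prodGaussian d|
      ≤ B * (√(∫ t, (1 + t ^ 2) ^ 2 ∂gaussianReal 0 1)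
        * √(∫ ω, min 1 |E ω| ∂prodGaussian d)) := by
  have hB : 0 ≤ B := (hρ0 0).trans (hρB 0)
  have iw := integrable_weight_dotProduct_snd hk hk1 ha
  have i1 : ∀ R : (Fin d → ℝ) × (Fin d → ℝ) → ℝ, Measurable R →
      Integrable (fun ω => k (a ⬝ᵥ ω.2) * metro (R ω) * ρ ω.1) (prodGaussian d) := fun R hR => by
    refine (iw.norm.mul_const B).mono' (Measurable.aestronglyMeasurable (by fun_prop))
      (ae_of_all _ fun ω => ?_)
    rw [norm_mul, norm_mul]
    refine mul_le_mul (mul_le_of_le_one_right (norm_nonneg _) (abs_metro_le_one _)) ?_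
      (norm_nonneg _) (norm_nonneg _)
    simpa [abs_of_nonneg (hρ0 _)] using hρB _
  have hmp : MeasurePreserving (fun ω : (Fin d → ℝ) × (Fin d → ℝ) => a ⬝ᵥ ω.2) (prodGaussian d)
      (gaussianReal 0 1) :=
    (measurePreserving_dotProduct_stdGaussian a ha).comp measurePreserving_snd
  have hm1 : MemLp (fun ω : (Fin d → ℝ) × (Fin d → ℝ) => 1 + (a ⬝ᵥ ω.2) ^ 2) 2
      (prodGaussian d) := by
    rw [memLp_two_iff_integrable_sq (by fun_prop)]
    exact hmp.integrable_comp_of_integrable integrable_one_add_sq_sq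
  have hmin0 : ∀ x : ℝ, 0 ≤ min 1 |x| := fun x => le_min zero_le_one (abs_nonneg x)
  have hmin1 : ∀ x : ℝ, min 1 |x| ≤ 1 := fun x => min_le_left _ _
  have hm2 : MemLp (fun ω => min 1 |E ω|) 2 (prodGaussian d) :=
    MemLp.of_bound (by fun_prop) 1 (ae_of_all _ fun ω => by
      rw [Real.norm_of_nonneg (hmin0 _)]; exact hmin1 _)
  rw [← integral_sub (i1 (fun ω => S ω + E ω) (hS.add hE)) (i1 S hS)]
  calc _ ≤ ∫ ω, |k (a ⬝ᵥ ω.2) * metro (S ω + E ω) * ρ ω.1 - k (a ⬝ᵥ ω.2) * metro (S ω) * ρ ω.1|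
        ∂prodGaussian d := abs_integral_le_integral_abs
    _ ≤ ∫ ω, B * ((1 + (a ⬝ᵥ ω.2) ^ 2) * min 1 |E ω|) ∂prodGaussian d := by
      refine integral_mono ((i1 (fun ω => S ω + E ω) (hS.add hE)).sub (i1 S hS)).abs
        ((hm1.integrable_mul hm2).const_mul B) fun ω => ?_
      dsimp only
      rw [← sub_mul, ← mul_sub, abs_mul, abs_mul, abs_of_nonneg (hρ0 _), mul_comm]
      have h := abs_metro_sub_le_min (S ω + E ω) (S ω)
      rw [add_sub_cancel_left] at h
      exact mul_le_mul (hρB _) (mul_le_mul (hk1 _) h (abs_nonneg _) (by positivity))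
        (by positivity) hB
    _ ≤ _ := by
      rw [integral_const_mul]
      refine mul_le_mul_of_nonneg_left ?_ hB
      refine (integral_mul_le_sqrt_mul_sqrt (fun ω => by positivity) (fun ω => hmin0 _)
        hm1 hm2).trans ?_
      refine mul_le_mul (le_of_eq ?_) (Real.sqrt_le_sqrt ?_) (Real.sqrt_nonneg _)
        (Real.sqrt_nonneg _)
      · congr 1
        rw [← hmp.map_eq, integral_map hmp.aemeasurable (by fun_prop)]
      · refine integral_mono hm2.integrable_sq (hm2.integrable (by norm_num)) fun ω => ?_
        dsimp only
        nlinarith [hmin0 (E ω), hmin1 (E ω)]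

end Equilibrium

noncomputable section SpectralReduction

variable {d : ℕ}

/-- The matrix with orthonormal eigenvectors the columns of `Q` and eigenvalues `f`. -/
def conjDiag (Q : Matrix (Fin d) (Fin d) ℝ) (f : Fin d → ℝ) : Matrix (Fin d) (Fin d) ℝ :=
  Q * diagonal f * Qᵀ

/-- Eigenvalues of the iteration matrix `Gsla`. -/
def slaEig (lam : Fin d → ℝ) (h : ℝ) (i : Fin d) : ℝ := 1 - h * lam i ^ 2 / 2

/-- The geometric sum `∑ l < L, g ^ (2 l)` of the eigenvalue `g` of `Gsla`. -/
def slaSum (lam : Fin d → ℝ) (h : ℝ) (L : ℕ) (i : Fin d) : ℝ :=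
  ∑ l ∈ Finset.range L, slaEig lam h i ^ (2 * l)

/-- Rescaled standard deviations of the proposal noise. -/
def slaNoise (lam : Fin d → ℝ) (h : ℝ) (L : ℕ) (i : Fin d) : ℝ :=
  √(h * lam i ^ 2 * slaSum lam h L i)

/-- The equilibrium state in spectral coordinates. -/
def specState (A : Matrix (Fin d) (Fin d) ℝ) (b : Fin d → ℝ) (Q : Matrix (Fin d) (Fin d) ℝ)
    (lam : Fin d → ℝ) (u : Fin d → ℝ) : Fin d → ℝ :=
  A⁻¹ *ᵥ b + Q *ᵥ fun i => u i / lam i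

/-- The `L`-step proposal in rescaled spectral coordinates. -/
def specStep (lam : Fin d → ℝ) (h : ℝ) (L : ℕ) (z w : Fin d → ℝ) (i : Fin d) : ℝ :=
  slaEig lam h i ^ L * z i + slaNoise lam h L i * w i

section ConjDiag

variable {Q : Matrix (Fin d) (Fin d) ℝ}

lemma conjDiag_one (hQ : Qᵀ * Q = 1) : conjDiag Q 1 = 1 := by
  simp [conjDiag, mul_eq_one_comm.mp hQ]

lemma conjDiag_sub (f g : Fin d → ℝ) : conjDiag Q f - conjDiag Q g = conjDiag Q (f - g) := by
  simp only [conjDiag, ← Matrix.sub_mul, ← Matrix.mul_sub, diagonal_sub]; rfl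

lemma conjDiag_smul (r : ℝ) (f : Fin d → ℝ) : r • conjDiag Q f = conjDiag Q (r • f) := by
  simp [conjDiag, diagonal_smul]

lemma conjDiag_mul (hQ : Qᵀ * Q = 1) (f g : Fin d → ℝ) :
    conjDiag Q f * conjDiag Q g = conjDiag Q (f * g) := by
  have : conjDiag Q f * conjDiag Q g = Q * diagonal f * (Qᵀ * Q) * diagonal g * Qᵀ := by
    simp only [conjDiag, Matrix.mul_assoc]
  rw [this, hQ, Matrix.mul_one, Matrix.mul_assoc Q, diagonal_mul_diagonal]
  rfl

lemma conjDiag_pow (hQ : Qᵀ * Q = 1) (f : Fin d → ℝ) (n : ℕ) :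
    conjDiag Q f ^ n = conjDiag Q (f ^ n) := by
  induction n with
  | zero => rw [pow_zero, pow_zero, conjDiag_one hQ]
  | succ n ih => rw [pow_succ, ih, conjDiag_mul hQ, pow_succ]

lemma conjDiag_sum {ι : Type*} (t : Finset ι) (f : ι → Fin d → ℝ) :
    ∑ j ∈ t, conjDiag Q (f j) = conjDiag Q (∑ j ∈ t, f j) := by
  simp only [conjDiag, ← Finset.sum_mul, ← Finset.mul_sum]
  congr 2
  ext i j
  by_cases hij : i = j
  · subst hij; simp [Matrix.sum_apply]
  · simp [Matrix.sum_apply, hij]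

lemma conjDiag_inv (hQ : Qᵀ * Q = 1) {f : Fin d → ℝ} (hf : ∀ i, f i ≠ 0) :
    (conjDiag Q f)⁻¹ = conjDiag Q f⁻¹ := by
  refine Matrix.inv_eq_right_inv ?_
  rw [conjDiag_mul hQ, ← conjDiag_one hQ]
  congr 1
  ext i
  simp [hf i]

lemma conjDiag_mulVec (hQ : Qᵀ * Q = 1) (f u : Fin d → ℝ) :
    conjDiag Q f *ᵥ (Q *ᵥ u) = Q *ᵥ (f * u) := by
  rw [conjDiag, mulVec_mulVec, Matrix.mul_assoc, hQ, Matrix.mul_one, ← mulVec_mulVec]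
  congr 1
  ext i
  simp [mulVec_diagonal]

lemma mulVec_dotProduct_mulVec_of_orthogonal (hQ : Qᵀ * Q = 1) (u v : Fin d → ℝ) :
    (Q *ᵥ u) ⬝ᵥ (Q *ᵥ v) = u ⬝ᵥ v := by
  rw [dotProduct_mulVec, vecMul_mulVec, ← dotProduct_mulVec, hQ, one_mulVec]

lemma snorm_mulVec (hQ : Qᵀ * Q = 1) {lam : Fin d → ℝ} (hlam : ∀ i, 0 < lam i) (s : ℝ)
    (u : Fin d → ℝ) : snorm Q lam s (Q *ᵥ u) = √(∑ i, lam i ^ (4 * s) * u i ^ 2) := by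
  have : Apow Q lam s = conjDiag Q (fun i => lam i ^ (2 * s)) := rfl
  rw [snorm, this, conjDiag_mulVec hQ, mulVec_dotProduct_mulVec_of_orthogonal hQ]
  congr 1
  refine Finset.sum_congr rfl fun i _ => ?_
  have h4 : lam i ^ (4 * s) = lam i ^ (2 * s) * lam i ^ (2 * s) := by
    rw [← Real.rpow_add (hlam i)]; ring_nf
  simp only [Pi.mul_apply, h4]
  ring

end ConjDiag

variable {A Q : Matrix (Fin d) (Fin d) ℝ} {lam : Fin d → ℝ}

lemma eq_conjDiag (hQ : Qᵀ * Q = 1) (hdA : (Qᵀ * A * Q).IsDiag)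
    (hlam : ∀ i, 0 < lam i ∧ lam i ^ 2 = (Qᵀ * A * Q) i i) :
    A = conjDiag Q (fun i => lam i ^ 2) := by
  have hQ' := mul_eq_one_comm.mp hQ
  have : diagonal (fun i => lam i ^ 2) = Qᵀ * A * Q := by
    rw [← hdA.diagonal_diag]
    congr 1
    ext i
    exact (hlam i).2
  rw [conjDiag, this]
  calc A = (Q * Qᵀ) * A * (Q * Qᵀ) := by simp [hQ']
    _ = _ := by simp only [Matrix.mul_assoc]

lemma conjDiag_sq_inv (hQ : Qᵀ * Q = 1) (hlam : ∀ i, 0 < lam i)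
    (hA : A = conjDiag Q (fun i => lam i ^ 2)) : A⁻¹ = conjDiag Q (fun i => (lam i ^ 2)⁻¹) := by
  rw [hA, conjDiag_inv hQ fun i => (pow_pos (hlam i) 2).ne']
  rfl

lemma gsla_eq (hQ : Qᵀ * Q = 1) (hA : A = conjDiag Q (fun i => lam i ^ 2)) (h : ℝ) :
    Gsla A h = conjDiag Q (slaEig lam h) := by
  rw [Gsla, hA, ← conjDiag_one hQ, conjDiag_smul, conjDiag_sub]
  congr 1
  ext i
  simp only [slaEig, Pi.sub_apply, Pi.one_apply, Pi.smul_apply, smul_eq_mul]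
  ring

lemma slaSum_pos (lam : Fin d → ℝ) (h : ℝ) {L : ℕ} (hL : 0 < L) (i : Fin d) :
    0 < slaSum lam h L i := by
  obtain ⟨n, rfl⟩ := Nat.exists_eq_succ_of_ne_zero hL.ne'
  rw [slaSum, Finset.sum_range_succ']
  have : 0 ≤ ∑ l ∈ Finset.range n, slaEig lam h i ^ (2 * (l + 1)) :=
    Finset.sum_nonneg fun l _ => by rw [pow_mul]; positivity
  simp only [mul_zero, pow_zero]
  linarith

lemma lsCov_eq (hQ : Qᵀ * Q = 1) (hA : A = conjDiag Q (fun i => lam i ^ 2)) (h : ℝ) (L : ℕ) :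
    lsCov A h L = conjDiag Q (fun i => h * slaSum lam h L i) := by
  simp only [lsCov, gsla_eq hQ hA, conjDiag_pow hQ, conjDiag_smul, conjDiag_sum]
  congr 1
  ext i
  simp [slaSum, Finset.mul_sum]

lemma lsMean_inv_mulVec_add (hQ : Qᵀ * Q = 1) (hlam : ∀ i, 0 < lam i)
    (hA : A = conjDiag Q (fun i => lam i ^ 2)) {h : ℝ} (hh : 0 < h) (b : Fin d → ℝ) (L : ℕ)
    (u : Fin d → ℝ) :
    lsMean A b h L (A⁻¹ *ᵥ b + u) = A⁻¹ *ᵥ b + Gsla A h ^ L *ᵥ u := by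
  have hG := gsla_eq hQ hA h
  have h1 : 1 - Gsla A h = conjDiag Q (fun i => h / 2 * lam i ^ 2) := by
    rw [hG, ← conjDiag_one hQ, conjDiag_sub]
    congr 1
    ext i
    simp only [slaEig, Pi.sub_apply, Pi.one_apply]
    ring
  have h2 : 1 - Gsla A h ^ L = conjDiag Q (1 - slaEig lam h ^ L) := by
    rw [hG, conjDiag_pow hQ, ← conjDiag_one hQ, conjDiag_sub]
  have key : ((1 - Gsla A h)⁻¹ * (1 - Gsla A h ^ L)) *ᵥ ((h / 2) • b)
      = (1 - Gsla A h ^ L) *ᵥ (A⁻¹ *ᵥ b) := by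
    rw [mulVec_smul, ← smul_mulVec, mulVec_mulVec]
    congr 1
    rw [h1, conjDiag_inv hQ fun i => (mul_pos (half_pos hh) (pow_pos (hlam i) 2)).ne', h2,
      conjDiag_sq_inv hQ hlam hA, conjDiag_mul hQ, conjDiag_mul hQ, conjDiag_smul]
    congr 1
    ext i
    have := (hlam i).ne'
    simp only [Pi.smul_apply, Pi.mul_apply, Pi.inv_apply, smul_eq_mul]
    field_simp
  rw [lsMean, key, mulVec_add, sub_mulVec, one_mulVec]
  abel

lemma lsMean_specState (hQ : Qᵀ * Q = 1) (hlam : ∀ i, 0 < lam i)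
    (hA : A = conjDiag Q (fun i => lam i ^ 2)) {h : ℝ} (hh : 0 < h) (b : Fin d → ℝ) (L : ℕ)
    (u : Fin d → ℝ) :
    lsMean A b h L (specState A b Q lam u) = specState A b Q lam (slaEig lam h ^ L * u) := by
  rw [specState, lsMean_inv_mulVec_add hQ hlam hA hh, gsla_eq hQ hA, conjDiag_pow hQ,
    conjDiag_mulVec hQ, specState]
  congr 2
  ext i
  simp [mul_div_assoc]

lemma specState_sub (b : Fin d → ℝ) (u v : Fin d → ℝ) :
    specState A b Q lam u - specState A b Q lam v = Q *ᵥ fun i => (u i - v i) / lam i := by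
  simp only [specState, add_sub_add_left_eq_sub, ← mulVec_sub]
  congr 1
  ext i
  simp [sub_div]

/-- In law, the equilibrium state and its proposal are given by independent spectral
coordinates. -/
lemma integral_xeq_ylstep (hQ : Qᵀ * Q = 1) (hlam : ∀ i, 0 < lam i)
    (hA : A = conjDiag Q (fun i => lam i ^ 2)) {h : ℝ} (hh : 0 < h) (b : Fin d → ℝ) (L : ℕ)
    {R CL : Matrix (Fin d) (Fin d) ℝ} (hR : R * Rᵀ = A⁻¹) (hCL : CL * CLᵀ = lsCov A h L)
    {H : (Fin d → ℝ) → (Fin d → ℝ) → ℝ} (hH : Measurable (Function.uncurry H)) :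
    ∫ ω, H (xeq A b R ω.1) (ylstep A b h L CL (xeq A b R ω.1) ω.2) ∂prodGaussian d
      = ∫ ω, H (specState A b Q lam ω.1) (specState A b Q lam (specStep lam h L ω.1 ω.2))
          ∂prodGaussian d := by
  set F : (Fin d → ℝ) × (Fin d → ℝ) → ℝ := fun p =>
    H (A⁻¹ *ᵥ b + p.1) (lsMean A b h L (A⁻¹ *ᵥ b + p.1) + p.2) with hF
  have hmeas : Measurable F := by
    have : Measurable (lsMean A b h L) := by unfold lsMean; fun_prop
    exact hH.comp (f := fun p : (Fin d → ℝ) × (Fin d → ℝ) =>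
      (A⁻¹ *ᵥ b + p.1, lsMean A b h L (A⁻¹ *ᵥ b + p.1) + p.2)) (by fun_prop)
  set R' : Matrix (Fin d) (Fin d) ℝ := Q * diagonal (fun i => (lam i)⁻¹) with hR'
  set C' : Matrix (Fin d) (Fin d) ℝ := Q * diagonal (fun i => √(h * slaSum lam h L i)) with hC'
  have hs : ∀ i, 0 ≤ slaSum lam h L i := fun i =>
    Finset.sum_nonneg fun l _ => by rw [pow_mul]; positivity
  have eR : R * Rᵀ = R' * R'ᵀ := by
    rw [hR, conjDiag_sq_inv hQ hlam hA, hR', transpose_mul, diagonal_transpose, Matrix.mul_assoc,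
      ← Matrix.mul_assoc (diagonal _), diagonal_mul_diagonal, ← Matrix.mul_assoc, conjDiag]
    congr 3
    ext i
    rw [pow_two, mul_inv]
  have eC : CL * CLᵀ = C' * C'ᵀ := by
    rw [hCL, lsCov_eq hQ hA, hC', transpose_mul, diagonal_transpose, Matrix.mul_assoc,
      ← Matrix.mul_assoc (diagonal _), diagonal_mul_diagonal, ← Matrix.mul_assoc, conjDiag]
    congr 3
    ext i
    rw [Real.mul_self_sqrt (mul_nonneg hh.le (hs i))]
  have push : ∀ M N : Matrix (Fin d) (Fin d) ℝ,
      ∫ ω, F (M *ᵥ ω.1, N *ᵥ ω.2) ∂prodGaussian d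
        = ∫ p, F p ∂((_root_.stdGaussian d).map (fun v => M *ᵥ v)).prod
            ((_root_.stdGaussian d).map (fun v => N *ᵥ v)) := fun M N => by
    rw [Measure.map_prod_map _ _ (by fun_prop) (by fun_prop), prodGaussian,
      integral_map (Measurable.aemeasurable (by fun_prop)) hmeas.aestronglyMeasurable]
    rfl
  have e1 : ∫ ω, F (R *ᵥ ω.1, CL *ᵥ ω.2) ∂prodGaussian d
      = ∫ ω, F (R' *ᵥ ω.1, C' *ᵥ ω.2) ∂prodGaussian d := by
    rw [push, push, stdGaussian_map_mulVec_eq R R' eR, stdGaussian_map_mulVec_eq CL C' eC]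
  refine e1.trans (integral_congr_ae (ae_of_all _ fun ω => ?_))
  have r1 : R' *ᵥ ω.1 = Q *ᵥ fun i => ω.1 i / lam i := by
    rw [hR', ← mulVec_mulVec]
    congr 1
    ext i
    rw [mulVec_diagonal, div_eq_inv_mul]
  have x1 : A⁻¹ *ᵥ b + R' *ᵥ ω.1 = specState A b Q lam ω.1 := by rw [r1]; rfl
  simp only [hF, x1, lsMean_specState hQ hlam hA hh]
  congr 1
  rw [specState, specState, hC', ← mulVec_mulVec, add_assoc, ← mulVec_add]
  congr 2
  ext i
  have hl := (hlam i).ne'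
  have e : h * lam i ^ 2 * slaSum lam h L i = lam i ^ 2 * (h * slaSum lam h L i) := by ring
  simp only [Pi.add_apply, Pi.mul_apply, Pi.pow_apply, mulVec_diagonal, specStep, slaNoise, e,
    Real.sqrt_mul (sq_nonneg (lam i)), Real.sqrt_sq (hlam i).le]
  field_simp

lemma lsPlog_specState (hQ : Qᵀ * Q = 1) (hlam : ∀ i, 0 < lam i)
    (hA : A = conjDiag Q (fun i => lam i ^ 2)) (b : Fin d → ℝ) (φ : (Fin d → ℝ) → ℝ)
    (u : Fin d → ℝ) :
    lsPlog A b φ (specState A b Q lam u)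
      = (A⁻¹ *ᵥ b) ⬝ᵥ b / 2 - (∑ i, u i ^ 2) / 2 - φ (specState A b Q lam u) := by
  have hb : A *ᵥ (A⁻¹ *ᵥ b) = b := by
    rw [mulVec_mulVec, conjDiag_sq_inv hQ hlam hA, hA, conjDiag_mul hQ]
    have : ((fun i => lam i ^ 2) * fun i => (lam i ^ 2)⁻¹ : Fin d → ℝ) = 1 := by
      ext i
      exact mul_inv_cancel₀ (pow_pos (hlam i) 2).ne'
    rw [this, conjDiag_one hQ, one_mulVec]
  set v : Fin d → ℝ := fun i => u i / lam i with hv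
  have hAv : A *ᵥ (Q *ᵥ v) = Q *ᵥ ((fun i => lam i ^ 2) * v) := by
    conv_lhs => rw [hA]
    rw [conjDiag_mulVec hQ]
  have hsym : (A⁻¹ *ᵥ b) ⬝ᵥ A *ᵥ (Q *ᵥ v) = b ⬝ᵥ (Q *ᵥ v) := by
    have hAt : Aᵀ = A := by
      rw [hA, conjDiag, transpose_mul, transpose_mul, transpose_transpose, diagonal_transpose,
        Matrix.mul_assoc]
    rw [dotProduct_mulVec, ← mulVec_transpose, hAt, hb]
  have hquad : (Q *ᵥ v) ⬝ᵥ A *ᵥ (Q *ᵥ v) = ∑ i, u i ^ 2 := by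
    rw [hAv, mulVec_dotProduct_mulVec_of_orthogonal hQ]
    refine Finset.sum_congr rfl fun i _ => ?_
    have := (hlam i).ne'
    simp only [hv, Pi.mul_apply]
    field_simp
  have hx : specState A b Q lam u = A⁻¹ *ᵥ b + Q *ᵥ v := rfl
  have e : lsPlog A b φ (specState A b Q lam u) = -(1/2) * ((A⁻¹ *ᵥ b + Q *ᵥ v) ⬝ᵥ
      A *ᵥ (A⁻¹ *ᵥ b + Q *ᵥ v)) + b ⬝ᵥ (A⁻¹ *ᵥ b + Q *ᵥ v) - φ (specState A b Q lam u) := rfl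
  rw [e, mulVec_add, dotProduct_add, add_dotProduct, add_dotProduct, hsym, hquad, hb,
    dotProduct_add, dotProduct_comm (Q *ᵥ v) b, dotProduct_comm b (A⁻¹ *ᵥ b)]
  ring

lemma lsQlog_specState (hQ : Qᵀ * Q = 1) (hlam : ∀ i, 0 < lam i)
    (hA : A = conjDiag Q (fun i => lam i ^ 2)) {h : ℝ} (hh : 0 < h) (b : Fin d → ℝ) {L : ℕ}
    (hL : 0 < L) (u v : Fin d → ℝ) :
    lsQlog A b h L (specState A b Q lam u) (specState A b Q lam v)
      = -(1/2) * ∑ i, (v i - slaEig lam h i ^ L * u i) ^ 2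
          / (lam i ^ 2 * (h * slaSum lam h L i)) := by
  rw [lsQlog, lsMean_specState hQ hlam hA hh, specState_sub, lsCov_eq hQ hA,
    conjDiag_inv hQ fun i => (mul_pos hh (slaSum_pos lam h hL i)).ne', conjDiag_mulVec hQ,
    mulVec_dotProduct_mulVec_of_orthogonal hQ]
  congr 1
  refine Finset.sum_congr rfl fun i _ => ?_
  have h1 := (hlam i).ne'
  have h2 := (mul_pos hh (slaSum_pos lam h hL i)).ne'
  simp only [Pi.mul_apply, Pi.pow_apply, Pi.inv_apply]
  field_simp

lemma one_sub_slaEig_pow (lam : Fin d → ℝ) (h : ℝ) (L : ℕ) (i : Fin d) :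
    1 - (slaEig lam h i ^ L) ^ 2
      = (h * lam i ^ 2 - (h * lam i ^ 2) ^ 2 / 4) * slaSum lam h L i := by
  have := mul_neg_geom_sum (slaEig lam h i ^ 2) L
  rw [← pow_mul, mul_comm 2 L, pow_mul] at this
  rw [← this, slaSum]
  simp only [pow_mul]
  congr 1
  rw [slaEig]
  ring

/-- The acceptance probability in spectral coordinates. -/
lemma lsAccept_specState (hQ : Qᵀ * Q = 1) (hlam : ∀ i, 0 < lam i)
    (hA : A = conjDiag Q (fun i => lam i ^ 2)) {h : ℝ} (hh : 0 < h) (b : Fin d → ℝ)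
    (φ : (Fin d → ℝ) → ℝ) {L : ℕ} (hL : 0 < L) (u v : Fin d → ℝ) :
    lsAccept A b φ h L (specState A b Q lam u) (specState A b Q lam v)
      = metro (φ (specState A b Q lam u) - φ (specState A b Q lam v)
          - ∑ i, h * lam i ^ 2 / 8 * (v i ^ 2 - u i ^ 2)) := by
  rw [lsAccept, metro]
  congr 2
  simp only [lsPlog_specState hQ hlam hA, lsQlog_specState hQ hlam hA hh b hL]
  have key : ∀ i, h * lam i ^ 2 / 8 * (v i ^ 2 - u i ^ 2)
      = 1/2 * (v i ^ 2 - u i ^ 2)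
        + 1/2 * ((u i - slaEig lam h i ^ L * v i) ^ 2 / (lam i ^ 2 * (h * slaSum lam h L i))
        - (v i - slaEig lam h i ^ L * u i) ^ 2 / (lam i ^ 2 * (h * slaSum lam h L i))) := by
    intro i
    have h1 := (hlam i).ne'
    have h2 := (slaSum_pos lam h hL i).ne'
    have h3 := hh.ne'
    have e : (u i - slaEig lam h i ^ L * v i) ^ 2 - (v i - slaEig lam h i ^ L * u i) ^ 2
        = ((h * lam i ^ 2 - (h * lam i ^ 2) ^ 2 / 4) * slaSum lam h L i) * (u i ^ 2 - v i ^ 2) := by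
      rw [← one_sub_slaEig_pow]; ring
    rw [← sub_div, e]
    field_simp
    ring
  simp only [key, Finset.sum_add_distrib, ← Finset.mul_sum, Finset.sum_sub_distrib]
  ring

end SpectralReduction

noncomputable section CoordinateBounds

variable {d : ℕ}

/-- Coefficients of the mixed terms in the log acceptance ratio. -/
def slaCross (lam : Fin d → ℝ) (h : ℝ) (L : ℕ) (i : Fin d) : ℝ :=
  -(h * lam i ^ 2 / 4 * slaEig lam h i ^ L * slaNoise lam h L i)

/-- The diagonal part of the log acceptance ratio. -/
def slaQuad (lam : Fin d → ℝ) (h : ℝ) (L : ℕ) (ω : (Fin d → ℝ) × (Fin d → ℝ)) : ℝ :=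
  ∑ i, h * lam i ^ 2 / 8 * (1 - (slaEig lam h i ^ L) ^ 2) * ω.1 i ^ 2
    - ∑ i, h * lam i ^ 2 / 8 * slaNoise lam h L i ^ 2 * ω.2 i ^ 2

lemma neg_sum_specStep_sq_sub (lam : Fin d → ℝ) (h : ℝ) (L : ℕ) (z w : Fin d → ℝ) :
    -∑ i, h * lam i ^ 2 / 8 * (specStep lam h L z w i ^ 2 - z i ^ 2)
      = slaQuad lam h L (z, w) + ∑ i, slaCross lam h L i * z i * w i := by
  rw [slaQuad, ← Finset.sum_neg_distrib, ← Finset.sum_sub_distrib, ← Finset.sum_add_distrib]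
  refine Finset.sum_congr rfl fun i _ => ?_
  rw [specStep, slaCross]
  ring

variable {lam : Fin d → ℝ} {h e : ℝ}

lemma slaEig_mem (hh : 0 ≤ h) (i : Fin d) (hi : h * lam i ^ 2 ≤ 1) :
    0 ≤ slaEig lam h i ∧ slaEig lam h i ≤ 1 := by
  have : 0 ≤ h * lam i ^ 2 := by positivity
  unfold slaEig
  constructor <;> linarith

lemma slaEig_pow_mem (hh : 0 ≤ h) (i : Fin d) (hi : h * lam i ^ 2 ≤ 1) (n : ℕ) :
    0 ≤ slaEig lam h i ^ n ∧ slaEig lam h i ^ n ≤ 1 :=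
  ⟨pow_nonneg (slaEig_mem hh i hi).1 n, pow_le_one₀ (slaEig_mem hh i hi).1 (slaEig_mem hh i hi).2⟩

lemma one_sub_slaEig_pow_le (i : Fin d) (hi : h * lam i ^ 2 ≤ 1) (n : ℕ) :
    1 - slaEig lam h i ^ n ≤ n * (h * lam i ^ 2) / 2 := by
  have := one_add_mul_le_pow (a := -(h * lam i ^ 2 / 2)) (by linarith) n
  rw [← sub_eq_add_neg] at this
  unfold slaEig
  linarith

lemma slaSum_nonneg (lam : Fin d → ℝ) (h : ℝ) (L : ℕ) (i : Fin d) : 0 ≤ slaSum lam h L i :=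
  Finset.sum_nonneg fun l _ => by rw [pow_mul]; positivity

lemma slaSum_le (hh : 0 ≤ h) (i : Fin d) (hi : h * lam i ^ 2 ≤ 1) (L : ℕ) :
    slaSum lam h L i ≤ L := by
  refine (Finset.sum_le_card_nsmul _ _ 1 fun l _ => (slaEig_pow_mem hh i hi _).2).trans ?_
  simp

lemma sub_slaSum_le (hh : 0 ≤ h) (i : Fin d) (hi : h * lam i ^ 2 ≤ 1) (L : ℕ) :
    L - slaSum lam h L i ≤ (L : ℝ) ^ 2 * (h * lam i ^ 2) := by
  have e : (L : ℝ) - slaSum lam h L i = ∑ l ∈ Finset.range L, (1 - slaEig lam h i ^ (2 * l)) := by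
    simp [slaSum]
  have h0 : 0 ≤ h * lam i ^ 2 := by positivity
  rw [e]
  refine (Finset.sum_le_card_nsmul _ _ (L * (h * lam i ^ 2)) fun l hl => ?_).trans ?_
  · refine (one_sub_slaEig_pow_le i hi _).trans ?_
    have : (l : ℝ) ≤ L := by exact_mod_cast (Finset.mem_range.mp hl).le
    push_cast
    nlinarith
  · simp only [Finset.card_range, nsmul_eq_mul]
    exact le_of_eq (by ring)

lemma slaNoise_sq (hh : 0 ≤ h) (L : ℕ) (i : Fin d) :
    slaNoise lam h L i ^ 2 = h * lam i ^ 2 * slaSum lam h L i :=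
  Real.sq_sqrt (mul_nonneg (by positivity) (slaSum_nonneg lam h L i))

lemma slaNoise_sq_le (hh : 0 ≤ h) (i : Fin d) (hi : h * lam i ^ 2 ≤ 1) (L : ℕ) :
    slaNoise lam h L i ^ 2 ≤ L * (h * lam i ^ 2) := by
  rw [slaNoise_sq hh, mul_comm (L : ℝ)]
  exact mul_le_mul_of_nonneg_left (slaSum_le hh i hi L) (by positivity)

lemma one_sub_slaEig_pow_sq_mem (hh : 0 ≤ h) (i : Fin d) (hi : h * lam i ^ 2 ≤ 1) (L : ℕ) :
    0 ≤ 1 - (slaEig lam h i ^ L) ^ 2 ∧ 1 - (slaEig lam h i ^ L) ^ 2 ≤ L * (h * lam i ^ 2) := by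
  have h1 := slaEig_pow_mem hh i hi L
  have h2 := one_sub_slaEig_pow_le i hi L
  constructor <;> nlinarith

lemma abs_sum_sub_le {S : Fin d → ℝ} {L : ℕ} {K θ : ℝ} (hh : 0 ≤ h)
    (hi : ∀ i, h * lam i ^ 2 ≤ e) (hK : 0 ≤ K)
    (hS : ∀ i, S i ≤ L) (hS' : ∀ i, L - S i ≤ K * (h * lam i ^ 2)) :
    |∑ i, (h * lam i ^ 2) ^ 3 * S i - L * θ|
      ≤ L * |∑ i, (h * lam i ^ 2) ^ 3 - θ| + K * (e * ∑ i, (h * lam i ^ 2) ^ 3) := by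
  have h0 : ∀ i, 0 ≤ h * lam i ^ 2 := fun i => by positivity
  have e1 : ∑ i, (h * lam i ^ 2) ^ 3 * S i - L * θ
      = L * (∑ i, (h * lam i ^ 2) ^ 3 - θ) - ∑ i, (h * lam i ^ 2) ^ 3 * (L - S i) := by
    simp only [mul_sub, Finset.sum_sub_distrib, ← Finset.sum_mul]
    ring
  have b0 : 0 ≤ ∑ i, (h * lam i ^ 2) ^ 3 * (L - S i) :=
    Finset.sum_nonneg fun i _ => mul_nonneg (pow_nonneg (h0 i) 3) (sub_nonneg.mpr (hS i))
  rw [e1]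
  refine (abs_sub _ _).trans ?_
  rw [abs_mul, Nat.abs_cast, abs_of_nonneg b0, Finset.mul_sum, Finset.mul_sum]
  refine add_le_add_right (Finset.sum_le_sum fun i _ => ?_) _
  calc (h * lam i ^ 2) ^ 3 * (L - S i) ≤ (h * lam i ^ 2) ^ 3 * (K * e) :=
        mul_le_mul_of_nonneg_left ((hS' i).trans (mul_le_mul_of_nonneg_left (hi i) hK))
          (pow_nonneg (h0 i) 3)
    _ = _ := by ring

/-- The diagonal part of the log acceptance ratio concentrates at its mean. -/
lemma integral_abs_slaQuad_sub_le (hh : 0 ≤ h) (hi : ∀ i, h * lam i ^ 2 ≤ e) (he : e ≤ 1)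
    (L : ℕ) (θ : ℝ) :
    Integrable (fun ω => |slaQuad lam h L ω - -(L * θ / 32)|) (prodGaussian d) ∧
    ∫ ω, |slaQuad lam h L ω - -(L * θ / 32)| ∂prodGaussian d
      ≤ (L * |∑ i, (h * lam i ^ 2) ^ 3 - θ| + L ^ 2 * (e * ∑ i, (h * lam i ^ 2) ^ 3))
        + 2 * √((∫ t, (t ^ 2 - 1) ^ 2 ∂gaussianReal 0 1)
          * (L ^ 2 * (e * ∑ i, (h * lam i ^ 2) ^ 3))) := by
  have h0 : ∀ i, 0 ≤ h * lam i ^ 2 := fun i => by positivity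
  have hi1 : ∀ i, h * lam i ^ 2 ≤ 1 := fun i => (hi i).trans he
  set u : Fin d → ℝ := fun i => h * lam i ^ 2 / 8 * (1 - (slaEig lam h i ^ L) ^ 2) with hu
  set v : Fin d → ℝ := fun i => h * lam i ^ 2 / 8 * slaNoise lam h L i ^ 2 with hv
  have hV : 0 ≤ ∫ t, (t ^ 2 - 1) ^ 2 ∂gaussianReal 0 1 := integral_nonneg fun t => by positivity
  have hsq : ∀ x : Fin d → ℝ, (∀ i, 0 ≤ x i) → (∀ i, x i ≤ L * (h * lam i ^ 2)) →
      ∑ i, (h * lam i ^ 2 / 8 * x i) ^ 2 ≤ L ^ 2 * (e * ∑ i, (h * lam i ^ 2) ^ 3) := by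
    intro x hx0 hx
    rw [Finset.mul_sum, Finset.mul_sum]
    refine Finset.sum_le_sum fun i _ => ?_
    have h1 : h * lam i ^ 2 / 8 * x i ≤ L * (h * lam i ^ 2) ^ 2 := by
      have := mul_le_mul_of_nonneg_left (hx i) (h0 i)
      have := mul_nonneg (h0 i) (hx0 i)
      nlinarith
    calc _ ≤ (L * (h * lam i ^ 2) ^ 2) ^ 2 :=
          pow_le_pow_left₀ (mul_nonneg (by linarith [h0 i]) (hx0 i)) h1 2
      _ = L ^ 2 * ((h * lam i ^ 2) * (h * lam i ^ 2) ^ 3) := by ring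
      _ ≤ _ := mul_le_mul_of_nonneg_left
          (mul_le_mul_of_nonneg_right (hi i) (pow_nonneg (h0 i) 3)) (by positivity)
  have hD : ∀ ω : (Fin d → ℝ) × (Fin d → ℝ), slaQuad lam h L ω - -(L * θ / 32)
      = (∑ i, (u i - v i) - -(L * θ / 32))
        + (∑ i, u i * (ω.1 i ^ 2 - 1) - ∑ i, v i * (ω.2 i ^ 2 - 1)) := fun ω => by
    have : slaQuad lam h L ω = ∑ i, u i * ω.1 i ^ 2 - ∑ i, v i * ω.2 i ^ 2 := rfl
    rw [this]
    simp only [mul_sub, Finset.sum_sub_distrib, mul_one]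
    ring
  have hmean : |∑ i, (u i - v i) - -(L * θ / 32)|
      ≤ L * |∑ i, (h * lam i ^ 2) ^ 3 - θ| + L ^ 2 * (e * ∑ i, (h * lam i ^ 2) ^ 3) := by
    have e1 : ∑ i, (u i - v i) - -(L * θ / 32)
        = -(∑ i, (h * lam i ^ 2) ^ 3 * slaSum lam h L i - L * θ) / 32 := by
      have : ∀ i, u i - v i = -((h * lam i ^ 2) ^ 3 * slaSum lam h L i) / 32 := fun i => by
        simp only [hu, hv, slaNoise_sq hh, one_sub_slaEig_pow]
        ring
      simp only [this, ← Finset.sum_div, Finset.sum_neg_distrib]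
      ring
    rw [e1, abs_div, abs_neg, abs_of_pos (by norm_num : (0 : ℝ) < 32)]
    refine le_trans (div_le_self (abs_nonneg _) (by norm_num)) ?_
    exact abs_sum_sub_le hh hi (by positivity) (fun i => slaSum_le hh i (hi1 i) L)
      (fun i => sub_slaSum_le hh i (hi1 i) L)
  have iu : Integrable (fun ω : (Fin d → ℝ) × (Fin d → ℝ) => |∑ i, u i * (ω.1 i ^ 2 - 1)|)
      (prodGaussian d) :=
    (((memLp_sum_mul_sq_sub_one_stdGaussian u).integrable (by norm_num)).comp_fst _).abs
  have iv : Integrable (fun ω : (Fin d → ℝ) × (Fin d → ℝ) => |∑ i, v i * (ω.2 i ^ 2 - 1)|)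
      (prodGaussian d) :=
    (((memLp_sum_mul_sq_sub_one_stdGaussian v).integrable (by norm_num)).comp_snd _).abs
  have hpt : ∀ ω : (Fin d → ℝ) × (Fin d → ℝ), |slaQuad lam h L ω - -(L * θ / 32)|
      ≤ |∑ i, (u i - v i) - -(L * θ / 32)|
        + (|∑ i, u i * (ω.1 i ^ 2 - 1)| + |∑ i, v i * (ω.2 i ^ 2 - 1)|) := fun ω => by
    rw [hD]
    exact (abs_add_le _ _).trans (add_le_add_right (abs_sub _ _) _)
  have hmeas : Measurable (fun ω => |slaQuad lam h L ω - -(L * θ / 32)|) := by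
    unfold slaQuad; fun_prop
  have iB := (integrable_const (μ := prodGaussian d) |∑ i, (u i - v i) - -(L * θ / 32)|).add
    (iu.add iv)
  have iE : Integrable (fun ω => |slaQuad lam h L ω - -(L * θ / 32)|) (prodGaussian d) :=
    iB.mono' hmeas.aestronglyMeasurable (ae_of_all _ fun ω => by
      rw [Real.norm_of_nonneg (abs_nonneg _)]; exact hpt ω)
  refine ⟨iE, (integral_mono iE iB hpt).trans ?_⟩
  have mp1 : MeasurePreserving (Prod.fst : (Fin d → ℝ) × (Fin d → ℝ) → _) (prodGaussian d)
    (_root_.stdGaussian d) := measurePreserving_fst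
  have mp2 : MeasurePreserving (Prod.snd : (Fin d → ℝ) × (Fin d → ℝ) → _) (prodGaussian d)
    (_root_.stdGaussian d) := measurePreserving_snd
  have E1 : ∫ ω : (Fin d → ℝ) × (Fin d → ℝ), |∑ i, u i * (ω.1 i ^ 2 - 1)| ∂prodGaussian d
      = ∫ z, |∑ i, u i * (z i ^ 2 - 1)| ∂_root_.stdGaussian d := by
    rw [← mp1.map_eq, integral_map mp1.aemeasurable (Measurable.aestronglyMeasurable
      (by fun_prop))]
  have E2 : ∫ ω : (Fin d → ℝ) × (Fin d → ℝ), |∑ i, v i * (ω.2 i ^ 2 - 1)| ∂prodGaussian d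
      = ∫ z, |∑ i, v i * (z i ^ 2 - 1)| ∂_root_.stdGaussian d := by
    rw [← mp2.map_eq, integral_map mp2.aemeasurable (Measurable.aestronglyMeasurable
      (by fun_prop))]
  have b1 := (integral_abs_sum_mul_sq_sub_one_le u).trans
    (Real.sqrt_le_sqrt (mul_le_mul_of_nonneg_left (hsq _
      (fun i => (one_sub_slaEig_pow_sq_mem hh i (hi1 i) L).1)
      (fun i => (one_sub_slaEig_pow_sq_mem hh i (hi1 i) L).2)) hV))
  have b2 := (integral_abs_sum_mul_sq_sub_one_le v).trans
    (Real.sqrt_le_sqrt (mul_le_mul_of_nonneg_left (hsq _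
      (fun i => sq_nonneg _) (fun i => slaNoise_sq_le hh i (hi1 i) L)) hV))
  have E3 := integral_add (integrable_const (μ := prodGaussian d)
    |∑ i, (u i - v i) - -(L * θ / 32)|) (iu.add iv)
  simp only [Pi.add_apply, integral_add iu iv, E1, E2, integral_const, probReal_univ,
    one_smul] at E3
  simp only [Pi.add_apply, E3]
  linarith

lemma slaCross_sq (hh : 0 ≤ h) (L : ℕ) (i : Fin d) : slaCross lam h L i ^ 2
    = (h * lam i ^ 2) ^ 3 * ((slaEig lam h i ^ L) ^ 2 * slaSum lam h L i) / 16 := by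
  rw [slaCross, neg_sq, mul_pow, mul_pow, slaNoise_sq hh]
  ring

lemma slaCross_sq_le (hh : 0 ≤ h) (i : Fin d) (hi : h * lam i ^ 2 ≤ 1) (L : ℕ) :
    slaCross lam h L i ^ 2 ≤ L * (h * lam i ^ 2) ^ 3 := by
  have h0 : 0 ≤ h * lam i ^ 2 := by positivity
  have h1 := slaEig_pow_mem hh i hi L
  have h2 := slaSum_le hh i hi L
  have h3 : (slaEig lam h i ^ L) ^ 2 * slaSum lam h L i ≤ 1 * L :=
    mul_le_mul (pow_le_one₀ h1.1 h1.2) h2 (slaSum_nonneg lam h L i) zero_le_one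
  have h4 := mul_le_mul_of_nonneg_left h3 (pow_nonneg h0 3)
  have h5 : 0 ≤ (h * lam i ^ 2) ^ 3 * L := by positivity
  rw [slaCross_sq hh]
  linarith

lemma abs_sum_slaCross_sq_sub_le (hh : 0 ≤ h) (hi : ∀ i, h * lam i ^ 2 ≤ e) (he : e ≤ 1)
    (L : ℕ) (θ : ℝ) :
    |∑ i, slaCross lam h L i ^ 2 - L * θ / 16|
      ≤ L * |∑ i, (h * lam i ^ 2) ^ 3 - θ| + 2 * L ^ 2 * (e * ∑ i, (h * lam i ^ 2) ^ 3) := by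
  have hi1 : ∀ i, h * lam i ^ 2 ≤ 1 := fun i => (hi i).trans he
  have e1 : ∑ i, slaCross lam h L i ^ 2 - L * θ / 16
      = (∑ i, (h * lam i ^ 2) ^ 3 * ((slaEig lam h i ^ L) ^ 2 * slaSum lam h L i)
        - L * θ) / 16 := by
    simp only [slaCross_sq hh, ← Finset.sum_div]
    ring
  rw [e1, abs_div, abs_of_pos (by norm_num : (0 : ℝ) < 16)]
  refine le_trans (div_le_self (abs_nonneg _) (by norm_num)) ?_
  refine abs_sum_sub_le hh hi (by positivity) (fun i => ?_) (fun i => ?_)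
  · have h1 := slaEig_pow_mem hh i (hi1 i) L
    exact (mul_le_of_le_one_left (slaSum_nonneg lam h L i) (pow_le_one₀ h1.1 h1.2)).trans
      (slaSum_le hh i (hi1 i) L)
  · have h1 := sub_slaSum_le hh i (hi1 i) L
    have h2 := one_sub_slaEig_pow_sq_mem hh i (hi1 i) L
    have h3 := mul_le_mul h2.2 (slaSum_le hh i (hi1 i) L) (slaSum_nonneg lam h L i)
      (h2.1.trans h2.2)
    linarith

lemma sum_slaCross_sq_sq_le (hh : 0 ≤ h) (hi : ∀ i, h * lam i ^ 2 ≤ e) (he : e ≤ 1) (L : ℕ) :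
    ∑ i, (slaCross lam h L i ^ 2) ^ 2 ≤ L ^ 2 * (e ^ 3 * ∑ i, (h * lam i ^ 2) ^ 3) := by
  rw [Finset.mul_sum, Finset.mul_sum]
  refine Finset.sum_le_sum fun i _ => ?_
  have h0 : 0 ≤ h * lam i ^ 2 := by positivity
  calc _ ≤ (L * (h * lam i ^ 2) ^ 3) ^ 2 :=
        pow_le_pow_left₀ (sq_nonneg _) (slaCross_sq_le hh i ((hi i).trans he) L) 2
    _ = L ^ 2 * ((h * lam i ^ 2) ^ 3 * (h * lam i ^ 2) ^ 3) := by ring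
    _ ≤ _ := mul_le_mul_of_nonneg_left (mul_le_mul_of_nonneg_right
        (pow_le_pow_left₀ h0 (hi i) 3) (pow_nonneg h0 3)) (by positivity)

lemma sum_mul_slaCross_sq_le (hh : 0 ≤ h) (hi : ∀ i, h * lam i ^ 2 ≤ e) (he : e ≤ 1) (L : ℕ)
    {a : Fin d → ℝ} (ha : a ⬝ᵥ a = 1) :
    ∑ i, (a i * slaCross lam h L i) ^ 2 ≤ L * e ^ 3 := by
  have : (L : ℝ) * e ^ 3 = ∑ i, a i * a i * (L * e ^ 3) := by
    rw [← Finset.sum_mul, ← dotProduct, ha, one_mul]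
  rw [this]
  refine Finset.sum_le_sum fun i _ => ?_
  have h0 : 0 ≤ h * lam i ^ 2 := by positivity
  rw [mul_pow, ← pow_two]
  exact mul_le_mul_of_nonneg_left ((slaCross_sq_le hh i ((hi i).trans he) L).trans
    (mul_le_mul_of_nonneg_left (pow_le_pow_left₀ h0 (hi i) 3) (Nat.cast_nonneg L))) (sq_nonneg _)

end CoordinateBounds

section PotentialPerturbation

variable {d : ℕ}

lemma integral_sum_mul_sq_prodGaussian (W α β : Fin d → ℝ) :
    Integrable (fun ω : (Fin d → ℝ) × (Fin d → ℝ) =>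
      ∑ i, W i * (2 * α i ^ 2 * ω.1 i ^ 2 + 2 * β i ^ 2 * ω.2 i ^ 2)) (prodGaussian d) ∧
    ∫ ω, ∑ i, W i * (2 * α i ^ 2 * ω.1 i ^ 2 + 2 * β i ^ 2 * ω.2 i ^ 2) ∂prodGaussian d
      = ∑ i, W i * (2 * (α i ^ 2 + β i ^ 2)) := by
  have mp1 : MeasurePreserving (Prod.fst : (Fin d → ℝ) × (Fin d → ℝ) → _) (prodGaussian d)
    (_root_.stdGaussian d) := measurePreserving_fst
  have mp2 : MeasurePreserving (Prod.snd : (Fin d → ℝ) × (Fin d → ℝ) → _) (prodGaussian d)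
    (_root_.stdGaussian d) := measurePreserving_snd
  have i1 : ∀ i, Integrable (fun ω : (Fin d → ℝ) × (Fin d → ℝ) => ω.1 i ^ 2) (prodGaussian d) :=
    fun i => mp1.integrable_comp_of_integrable (integrable_coord_sq_stdGaussian i)
  have i2 : ∀ i, Integrable (fun ω : (Fin d → ℝ) × (Fin d → ℝ) => ω.2 i ^ 2) (prodGaussian d) :=
    fun i => mp2.integrable_comp_of_integrable (integrable_coord_sq_stdGaussian i)
  have v1 : ∀ i, ∫ ω : (Fin d → ℝ) × (Fin d → ℝ), ω.1 i ^ 2 ∂prodGaussian d = 1 := fun i => by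
    rw [← integral_coord_sq_stdGaussian i, ← mp1.map_eq, integral_map mp1.aemeasurable
      (Measurable.aestronglyMeasurable (by fun_prop))]
  have v2 : ∀ i, ∫ ω : (Fin d → ℝ) × (Fin d → ℝ), ω.2 i ^ 2 ∂prodGaussian d = 1 := fun i => by
    rw [← integral_coord_sq_stdGaussian i, ← mp2.map_eq, integral_map mp2.aemeasurable
      (Measurable.aestronglyMeasurable (by fun_prop))]
  have i3 : ∀ i, Integrable (fun ω : (Fin d → ℝ) × (Fin d → ℝ) =>
      W i * (2 * α i ^ 2 * ω.1 i ^ 2 + 2 * β i ^ 2 * ω.2 i ^ 2)) (prodGaussian d) := fun i =>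
    (((i1 i).const_mul _).add ((i2 i).const_mul _)).const_mul _
  refine ⟨integrable_finsetSum _ fun i _ => i3 i, ?_⟩
  rw [integral_finsetSum _ fun i _ => i3 i]
  refine Finset.sum_congr rfl fun i _ => ?_
  rw [integral_const_mul, integral_add ((i1 i).const_mul _) ((i2 i).const_mul _),
    integral_const_mul, integral_const_mul, v1, v2]
  ring

lemma integral_sum_mul_add_sq_le {W : Fin d → ℝ} (hW : ∀ i, 0 ≤ W i) (α β : Fin d → ℝ) {K : ℝ}
    (hK : ∀ i, α i ^ 2 + β i ^ 2 ≤ K) :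
    Integrable (fun ω : (Fin d → ℝ) × (Fin d → ℝ) => ∑ i, W i * (α i * ω.1 i + β i * ω.2 i) ^ 2)
      (prodGaussian d) ∧
    ∫ ω, ∑ i, W i * (α i * ω.1 i + β i * ω.2 i) ^ 2 ∂prodGaussian d ≤ 2 * K * ∑ i, W i := by
  obtain ⟨h1, h2⟩ := integral_sum_mul_sq_prodGaussian W α β
  have hpt : ∀ ω : (Fin d → ℝ) × (Fin d → ℝ), ∑ i, W i * (α i * ω.1 i + β i * ω.2 i) ^ 2
      ≤ ∑ i, W i * (2 * α i ^ 2 * ω.1 i ^ 2 + 2 * β i ^ 2 * ω.2 i ^ 2) := fun ω =>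
    Finset.sum_le_sum fun i _ => mul_le_mul_of_nonneg_left
      (by nlinarith [sq_nonneg (α i * ω.1 i - β i * ω.2 i)]) (hW i)
  have h0 : ∀ ω : (Fin d → ℝ) × (Fin d → ℝ), 0 ≤ ∑ i, W i * (α i * ω.1 i + β i * ω.2 i) ^ 2 :=
    fun ω => Finset.sum_nonneg fun i _ => mul_nonneg (hW i) (sq_nonneg _)
  have hi : Integrable (fun ω : (Fin d → ℝ) × (Fin d → ℝ) =>
      ∑ i, W i * (α i * ω.1 i + β i * ω.2 i) ^ 2) (prodGaussian d) :=
    h1.mono' (Measurable.aestronglyMeasurable (by fun_prop)) (ae_of_all _ fun ω => by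
      rw [Real.norm_of_nonneg (h0 ω)]; exact hpt ω)
  refine ⟨hi, (integral_mono hi h1 hpt).trans ?_⟩
  rw [h2, Finset.mul_sum]
  refine Finset.sum_le_sum fun i _ => ?_
  have := mul_le_mul_of_nonneg_left (hK i) (hW i)
  linarith

lemma min_one_abs_le_of_local_lipschitz {x y p q n K r : ℝ} (hr : 0 < r) (hp : 0 ≤ p) (hq : 0 ≤ q)
    (hK : 0 ≤ K) {δfun : ℝ → ℝ → ℝ}
    (hδ : ∀ a c : ℝ, |a| ≤ r → |c| ≤ r → δfun a c ≤ K)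
    (hxy : |x - y| ≤ δfun √p √q * √n) :
    min 1 |x - y| ≤ (p + q) / r ^ 2 + K * √n := by
  by_cases hle : √p ≤ r ∧ √q ≤ r
  · refine (min_le_right _ _).trans (hxy.trans ?_)
    have := mul_le_mul_of_nonneg_right
      (hδ √p √q (by rw [abs_of_nonneg (Real.sqrt_nonneg _)]; exact hle.1)
      (by rw [abs_of_nonneg (Real.sqrt_nonneg _)]; exact hle.2)) (Real.sqrt_nonneg n)
    have h2 : 0 ≤ (p + q) / r ^ 2 := by positivity
    linarith
  · refine (min_le_left _ _).trans ?_
    have h3 : 0 ≤ K * √n := by positivity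
    have h4 : 1 ≤ (p + q) / r ^ 2 := by
      rw [one_le_div (by positivity)]
      rw [not_and_or, not_le, not_le, Real.lt_sqrt hr.le, Real.lt_sqrt hr.le] at hle
      rcases hle with h | h <;> linarith
    linarith

/-- The potential difference between a state and its proposal is small in probability. -/
lemma integral_min_one_abs_potential_sub_le {A Q : Matrix (Fin d) (Fin d) ℝ} {lam : Fin d → ℝ}
    {h e : ℝ} (hQ : Qᵀ * Q = 1) (hlam : ∀ i, 0 < lam i) (hh : 0 ≤ h)
    (hi : ∀ i, h * lam i ^ 2 ≤ e) (he : e ≤ 1) (b : Fin d → ℝ) (L : ℕ)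
    {φ : (Fin d → ℝ) → ℝ} (hφ : Measurable φ) {s s' K r : ℝ} (hr : 0 < r) (hK : 0 ≤ K)
    {δfun : ℝ → ℝ → ℝ} (hδ : ∀ a c : ℝ, |a| ≤ r → |c| ≤ r → δfun a c ≤ K)
    (hlip : ∀ x y : Fin d → ℝ, |φ x - φ y| ≤
      δfun (snorm Q lam s (x - A⁻¹ *ᵥ b)) (snorm Q lam s (y - A⁻¹ *ᵥ b))
        * snorm Q lam s' (x - y)) :
    ∫ ω, min 1 |φ (specState A b Q lam ω.1) - φ (specState A b Q lam (specStep lam h L ω.1 ω.2))|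
        ∂prodGaussian d
      ≤ (2 * (2 + L) * ∑ i, lam i ^ (4 * s) / lam i ^ 2) / r ^ 2
        + K * √(4 * L * e * ∑ i, lam i ^ (4 * s') / lam i ^ 2) := by
  have h0 : ∀ i, 0 ≤ h * lam i ^ 2 := fun i => by positivity
  have hi1 : ∀ i, h * lam i ^ 2 ≤ 1 := fun i => (hi i).trans he
  set G : Fin d → ℝ := fun i => slaEig lam h i ^ L with hG
  have hG01 := fun i => slaEig_pow_mem hh i (hi1 i) L
  have hW : ∀ (t : ℝ) (i : Fin d), 0 ≤ lam i ^ (4 * t) / lam i ^ 2 := fun t i => by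
    have := hlam i
    positivity
  have hx := integral_sum_mul_add_sq_le (hW s) 1 0 (K := 1) (by simp)
  have hy := integral_sum_mul_add_sq_le (hW s) G (slaNoise lam h L) (K := 1 + L) fun i => by
    have h1 := pow_le_one₀ (n := 2) (hG01 i).1 (hG01 i).2
    have h2 := slaNoise_sq_le hh i (hi1 i) L
    have h3 := mul_le_mul_of_nonneg_left (hi1 i) (Nat.cast_nonneg (α := ℝ) L)
    simp only [hG]
    linarith
  have hxy := integral_sum_mul_add_sq_le (hW s') (1 - G) (-slaNoise lam h L) (K := 2 * L * e)
    fun i => by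
    have h1 := one_sub_slaEig_pow_le i (hi1 i) L
    have h2 := slaNoise_sq_le hh i (hi1 i) L
    have h3 := mul_le_mul_of_nonneg_left (hi i) (Nat.cast_nonneg (α := ℝ) L)
    have h4 := hG01 i
    have h5 : (1 - slaEig lam h i ^ L) ^ 2 ≤ 1 - slaEig lam h i ^ L := by nlinarith
    have h6 : 0 ≤ L * (h * lam i ^ 2) := by positivity
    simp only [hG, Pi.sub_apply, Pi.one_apply, Pi.neg_apply, neg_sq]
    linarith
  set P : (Fin d → ℝ) × (Fin d → ℝ) → ℝ := fun ω => ∑ i, lam i ^ (4 * s) / lam i ^ 2 *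
    ((1 : Fin d → ℝ) i * ω.1 i + (0 : Fin d → ℝ) i * ω.2 i) ^ 2 with hP
  set P' : (Fin d → ℝ) × (Fin d → ℝ) → ℝ := fun ω => ∑ i, lam i ^ (4 * s) / lam i ^ 2 *
    (G i * ω.1 i + slaNoise lam h L i * ω.2 i) ^ 2 with hP'
  set N : (Fin d → ℝ) × (Fin d → ℝ) → ℝ := fun ω => ∑ i, lam i ^ (4 * s') / lam i ^ 2 *
    ((1 - G) i * ω.1 i + (-slaNoise lam h L) i * ω.2 i) ^ 2 with hN
  have nonneg : ∀ (t : ℝ) (x : Fin d → ℝ), 0 ≤ ∑ i, lam i ^ (4 * t) / lam i ^ 2 * x i ^ 2 :=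
    fun t x => Finset.sum_nonneg fun i _ => mul_nonneg (hW t i) (sq_nonneg _)
  have norm_eq : ∀ (t : ℝ) (u : Fin d → ℝ), snorm Q lam t (Q *ᵥ fun i => u i / lam i)
      = √(∑ i, lam i ^ (4 * t) / lam i ^ 2 * u i ^ 2) := fun t u => by
    rw [snorm_mulVec hQ hlam]
    congr 1
    refine Finset.sum_congr rfl fun i _ => ?_
    rw [div_pow, mul_div_assoc', div_mul_eq_mul_div]
  have sub_eq : ∀ u, specState A b Q lam u - A⁻¹ *ᵥ b = Q *ᵥ fun i => u i / lam i := fun u => by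
    rw [specState, add_sub_cancel_left]
  have hsqrt := integral_sqrt_le_sqrt_integral (μ := prodGaussian d) (X := N)
    (fun ω => nonneg s' _) hxy.1
  have iB : Integrable (fun ω => (P ω + P' ω) / r ^ 2 + K * √(N ω)) (prodGaussian d) :=
    ((hx.1.add hy.1).div_const _).add (hsqrt.1.const_mul K)
  have hpt : ∀ ω : (Fin d → ℝ) × (Fin d → ℝ),
      min 1 |φ (specState A b Q lam ω.1) - φ (specState A b Q lam (specStep lam h L ω.1 ω.2))|
        ≤ (P ω + P' ω) / r ^ 2 + K * √(N ω) := fun ω => by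
    refine min_one_abs_le_of_local_lipschitz hr (nonneg s _) (nonneg s _) hK hδ ?_
    have p1 : ∑ i, lam i ^ (4 * s) / lam i ^ 2 * ω.1 i ^ 2 = P ω := by simp [hP]
    have p2 : ∑ i, lam i ^ (4 * s') / lam i ^ 2 * (ω.1 i - specStep lam h L ω.1 ω.2 i) ^ 2 = N ω :=
      Finset.sum_congr rfl fun i _ => by
        simp only [hG, specStep, Pi.sub_apply, Pi.one_apply, Pi.neg_apply]
        ring
    have := hlip (specState A b Q lam ω.1) (specState A b Q lam (specStep lam h L ω.1 ω.2))
    rw [sub_eq, sub_eq, specState_sub, norm_eq, norm_eq, norm_eq, p1, p2] at this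
    exact this
  have iE : Integrable (fun ω : (Fin d → ℝ) × (Fin d → ℝ) =>
      min 1 |φ (specState A b Q lam ω.1) - φ (specState A b Q lam (specStep lam h L ω.1 ω.2))|)
      (prodGaussian d) := by
    refine iB.mono' (Measurable.aestronglyMeasurable ?_) (ae_of_all _ fun ω => ?_)
    · unfold specState specStep
      fun_prop
    · rw [Real.norm_of_nonneg (le_min zero_le_one (abs_nonneg _))]
      exact hpt ω
  have E1 : ∫ ω, (P ω + P' ω) / r ^ 2 + K * √(N ω) ∂prodGaussian d
      = (∫ ω, P ω ∂prodGaussian d + ∫ ω, P' ω ∂prodGaussian d) / r ^ 2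
        + K * ∫ ω, √(N ω) ∂prodGaussian d := by
    have E2 := integral_add ((hx.1.add hy.1).div_const (r ^ 2)) (hsqrt.1.const_mul K)
    have E3 := integral_add hx.1 hy.1
    simp only [Pi.add_apply, integral_div, integral_const_mul] at E2 E3
    rw [E2, E3]
  refine (integral_mono iE iB hpt).trans ?_
  rw [E1]
  refine add_le_add (div_le_div_of_nonneg_right ?_ (by positivity))
    (mul_le_mul_of_nonneg_left (hsqrt.2.trans (Real.sqrt_le_sqrt ?_)) hK)
  · linarith [hx.2, hy.2]
  · linarith [hxy.2]

end PotentialPerturbation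

noncomputable section WeightedAcceptance

variable {d : ℕ}

/-- Bound on the deviation of the weighted acceptance probability from its limit, in terms of
`X`, the size of the potential difference, `e`, a bound on the eigenvalues of `h • A`, and `T`, the
sum of their cubes. -/
def acceptBound (m : ℝ) (L : ℕ) (θ X e T : ℝ) : ℝ :=
  Real.exp (-m) * (√(∫ t, (1 + t ^ 2) ^ 2 ∂gaussianReal 0 1)
      * √(X + (L * |T - θ| + L ^ 2 * (e * T)
        + 2 * √((∫ t, (t ^ 2 - 1) ^ 2 ∂gaussianReal 0 1) * (L ^ 2 * (e * T))))))
    + Real.exp (-m) * (weightConst * (√(L * e ^ 3) + √(L * |T - θ| + 2 * L ^ 2 * (e * T)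
        + √((∫ t, (t ^ 2 - 1) ^ 2 ∂gaussianReal 0 1) * (L ^ 2 * (e ^ 3 * T))))))

lemma tendsto_acceptBound {ι : Type*} {F : Filter ι} (m : ℝ) (L : ℕ) {θ : ℝ} {X e T : ι → ℝ}
    (hX : Tendsto X F (𝓝 0)) (he : Tendsto e F (𝓝 0)) (hT : Tendsto T F (𝓝 θ)) :
    Tendsto (fun j => acceptBound m L θ (X j) (e j) (T j)) F (𝓝 0) := by
  have hc : Continuous fun p : ℝ × ℝ × ℝ => acceptBound m L θ p.1 p.2.1 p.2.2 := by
    unfold acceptBound; fun_prop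
  have h0 : acceptBound m L θ 0 0 θ = 0 := by simp [acceptBound]
  have := (hc.tendsto (0, 0, θ)).comp (hX.prodMk_nhds (he.prodMk_nhds hT))
  rw [h0] at this
  exact this

lemma min_one_abs_add_le (x y : ℝ) : min 1 |x + y| ≤ min 1 |x| + |y| := by
  rcases le_total 1 |x| with h | h
  · rw [min_eq_left h]
    exact (min_le_left _ _).trans (by linarith [abs_nonneg y])
  · rw [min_eq_right h]
    exact (min_le_right _ _).trans (abs_add_le x y)

lemma abs_integral_weight_lsAccept_sub_le {k : ℝ → ℝ} (hk : Measurable k)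
    (hk1 : ∀ t, |k t| ≤ 1 + t ^ 2) {A Q : Matrix (Fin d) (Fin d) ℝ} {lam : Fin d → ℝ}
    {h e m θ : ℝ} (hQ : Qᵀ * Q = 1) (hlam : ∀ i, 0 < lam i)
    (hA : A = conjDiag Q (fun i => lam i ^ 2)) (hh : 0 < h)
    (hi : ∀ i, h * lam i ^ 2 ≤ e) (he : e ≤ 1) (b : Fin d → ℝ) {L : ℕ} (hL : 0 < L)
    {φ : (Fin d → ℝ) → ℝ} (hφ : Measurable φ) (hm : ∀ x, m ≤ φ x) (hθ : 0 ≤ θ)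
    (hnorm : ∫ z, Real.exp (-φ (specState A b Q lam z)) ∂_root_.stdGaussian d = 1)
    {a : Fin d → ℝ} (ha : a ⬝ᵥ a = 1) :
    |∫ ω, k (a ⬝ᵥ ω.2) * lsAccept A b φ h L (specState A b Q lam ω.1)
          (specState A b Q lam (specStep lam h L ω.1 ω.2))
          * Real.exp (-φ (specState A b Q lam ω.1)) ∂prodGaussian d
        - (∫ t, k t ∂gaussianReal 0 1) * (2 * Phi (-(√(L * θ) / 4) / 2))|
      ≤ acceptBound m L θ (∫ ω, min 1 |φ (specState A b Q lam ω.1)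
          - φ (specState A b Q lam (specStep lam h L ω.1 ω.2))| ∂prodGaussian d) e
          (∑ i, (h * lam i ^ 2) ^ 3) := by
  set σ := √(L * θ) / 4 with hσ
  have hσ0 : 0 ≤ σ := by positivity
  have hσ2 : σ ^ 2 = L * θ / 16 := by
    rw [hσ, div_pow, Real.sq_sqrt (by positivity)]; norm_num
  set ρ : (Fin d → ℝ) → ℝ := fun z => Real.exp (-φ (specState A b Q lam z)) with hρ
  have hstate : Measurable (specState A b Q lam) := by unfold specState; fun_prop
  have hρm : Measurable ρ := by fun_prop
  have hρ0 : ∀ z, 0 ≤ ρ z := fun z => (Real.exp_pos _).le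
  have hρB : ∀ z, ρ z ≤ Real.exp (-m) := fun z => Real.exp_le_exp.mpr (neg_le_neg (hm _))
  set Δ : (Fin d → ℝ) × (Fin d → ℝ) → ℝ := fun ω => φ (specState A b Q lam ω.1)
    - φ (specState A b Q lam (specStep lam h L ω.1 ω.2)) with hΔ
  have hΔm : Measurable Δ := by
    have : Measurable fun ω : (Fin d → ℝ) × (Fin d → ℝ) => specStep lam h L ω.1 ω.2 := by
      unfold specStep; fun_prop
    fun_prop
  have hqm : Measurable (slaQuad lam h L) := by unfold slaQuad; fun_prop
  set M : ℝ := -(σ ^ 2) / 2 with hM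
  have hM' : M = -(L * θ / 32) := by rw [hM, hσ2]; ring
  set E : (Fin d → ℝ) × (Fin d → ℝ) → ℝ := fun ω =>
    Δ ω + (slaQuad lam h L ω - -(L * θ / 32)) with hE
  have hEm : Measurable E := by fun_prop
  set S : (Fin d → ℝ) × (Fin d → ℝ) → ℝ := fun ω =>
    M + ∑ i, slaCross lam h L i * ω.1 i * ω.2 i with hS
  have hSm : Measurable S := by fun_prop
  have hacc : ∀ ω : (Fin d → ℝ) × (Fin d → ℝ), lsAccept A b φ h L (specState A b Q lam ω.1)
      (specState A b Q lam (specStep lam h L ω.1 ω.2)) = metro (S ω + E ω) := fun ω => by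
    rw [lsAccept_specState hQ hlam hA hh b φ hL, sub_eq_add_neg _ (Finset.sum _ _),
      neg_sum_specStep_sq_sub]
    simp only [hS, hE, hΔ, hM']
    congr 1
    ring
  simp only [hacc]
  obtain ⟨iq, hq⟩ := integral_abs_slaQuad_sub_le hh.le hi he L θ
  have iΔ : Integrable (fun ω => min 1 |Δ ω|) (prodGaussian d) :=
    (integrable_const (1 : ℝ)).mono' (Measurable.aestronglyMeasurable (by fun_prop))
      (ae_of_all _ fun ω => by
        rw [Real.norm_of_nonneg (le_min zero_le_one (abs_nonneg _))]; exact min_le_left _ _)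
  have iE : Integrable (fun ω => min 1 |E ω|) (prodGaussian d) :=
    (integrable_const (1 : ℝ)).mono' (Measurable.aestronglyMeasurable (by fun_prop))
      (ae_of_all _ fun ω => by
        rw [Real.norm_of_nonneg (le_min zero_le_one (abs_nonneg _))]; exact min_le_left _ _)
  have hEint : ∫ ω, min 1 |E ω| ∂prodGaussian d ≤ ∫ ω, min 1 |Δ ω| ∂prodGaussian d
      + ((L * |∑ i, (h * lam i ^ 2) ^ 3 - θ| + L ^ 2 * (e * ∑ i, (h * lam i ^ 2) ^ 3))
        + 2 * √((∫ t, (t ^ 2 - 1) ^ 2 ∂gaussianReal 0 1)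
          * (L ^ 2 * (e * ∑ i, (h * lam i ^ 2) ^ 3)))) := by
    refine (integral_mono iE (iΔ.add iq) fun ω => min_one_abs_add_le _ _).trans ?_
    have := integral_add iΔ iq
    simp only [Pi.add_apply, this]
    exact add_le_add_right hq _
  have p1 := abs_integral_weight_metro_perturb_le hk hk1 ha hρm hρ0 hρB hSm hEm
  have p2 := abs_integral_weight_metro_density_sub_le hk hk1 ha (slaCross lam h L) hρm hρ0 hρB
    hnorm M hσ0
  have hmetro := integral_metro_gaussianReal hσ0
  rw [← hM] at hmetro
  rw [hmetro, hσ2] at p2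
  have hV : 0 ≤ ∫ t, (t ^ 2 - 1) ^ 2 ∂gaussianReal 0 1 := integral_nonneg fun t => by positivity
  refine (abs_sub_le _ (∫ ω, k (a ⬝ᵥ ω.2) * metro (S ω) * ρ ω.1 ∂prodGaussian d) _).trans
    (add_le_add (p1.trans ?_) (p2.trans ?_))
  · gcongr
  · have w := weightConst_nonneg
    have b1 := sum_mul_slaCross_sq_le hh.le hi he L ha
    have b2 := abs_sum_slaCross_sq_sub_le hh.le hi he L θ
    have b3 := sum_slaCross_sq_sq_le hh.le hi he L
    gcongr

end WeightedAcceptance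

section Displacement

variable {d : ℕ}

lemma measurable_lsAccept {A : Matrix (Fin d) (Fin d) ℝ} {b : Fin d → ℝ} {φ : (Fin d → ℝ) → ℝ}
    (hφ : Measurable φ) (h : ℝ) (L : ℕ) :
    Measurable fun p : (Fin d → ℝ) × (Fin d → ℝ) => lsAccept A b φ h L p.1 p.2 := by
  unfold lsAccept lsPlog lsQlog lsMean dotProduct
  fun_prop

lemma lsAccept_nonneg (A : Matrix (Fin d) (Fin d) ℝ) (b : Fin d → ℝ) (φ : (Fin d → ℝ) → ℝ)
    (h : ℝ) (L : ℕ) (x y : Fin d → ℝ) : 0 ≤ lsAccept A b φ h L x y :=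
  le_min zero_le_one (Real.exp_pos _).le

lemma lsAccept_le_one (A : Matrix (Fin d) (Fin d) ℝ) (b : Fin d → ℝ) (φ : (Fin d → ℝ) → ℝ)
    (h : ℝ) (L : ℕ) (x y : Fin d → ℝ) : lsAccept A b φ h L x y ≤ 1 :=
  min_le_left _ _

/-- A linear combination of the state and noise coordinates along `a` has weighted second moment
governed by the noise part when the coefficient of the state is small. -/
lemma abs_integral_sq_mul_sub_le {a : Fin d → ℝ} (ha : a ⬝ᵥ a = 1) (p q c : ℝ) {B : ℝ}
    {F : (Fin d → ℝ) × (Fin d → ℝ) → ℝ} (hF : Measurable F) (hF0 : ∀ ω, 0 ≤ F ω)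
    (hFB : ∀ ω, F ω ≤ B) :
    |∫ ω, (p * (a ⬝ᵥ ω.1) + q * (a ⬝ᵥ ω.2)) ^ 2 * F ω ∂prodGaussian d
        - c * ∫ ω, (a ⬝ᵥ ω.2) ^ 2 * F ω ∂prodGaussian d|
      ≤ B * (p ^ 2 + 2 * |p * q| + |q ^ 2 - c|) := by
  have hB : 0 ≤ B := (hF0 0).trans (hFB 0)
  have mp1 : MeasurePreserving (fun ω : (Fin d → ℝ) × (Fin d → ℝ) => a ⬝ᵥ ω.1) (prodGaussian d)
      (gaussianReal 0 1) :=
    (measurePreserving_dotProduct_stdGaussian a ha).comp measurePreserving_fst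
  have mp2 : MeasurePreserving (fun ω : (Fin d → ℝ) × (Fin d → ℝ) => a ⬝ᵥ ω.2) (prodGaussian d)
      (gaussianReal 0 1) :=
    (measurePreserving_dotProduct_stdGaussian a ha).comp measurePreserving_snd
  have i1 : Integrable (fun ω : (Fin d → ℝ) × (Fin d → ℝ) => (a ⬝ᵥ ω.1) ^ 2) (prodGaussian d) :=
    mp1.integrable_comp_of_integrable (integrable_pow_gaussianReal 2)
  have i2 : Integrable (fun ω : (Fin d → ℝ) × (Fin d → ℝ) => (a ⬝ᵥ ω.2) ^ 2) (prodGaussian d) :=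
    mp2.integrable_comp_of_integrable (integrable_pow_gaussianReal 2)
  have v1 : ∫ ω : (Fin d → ℝ) × (Fin d → ℝ), (a ⬝ᵥ ω.1) ^ 2 ∂prodGaussian d = 1 := by
    rw [← integral_sq_gaussianReal, ← mp1.map_eq, integral_map mp1.aemeasurable
      (Measurable.aestronglyMeasurable (by fun_prop))]
  have v2 : ∫ ω : (Fin d → ℝ) × (Fin d → ℝ), (a ⬝ᵥ ω.2) ^ 2 ∂prodGaussian d = 1 := by
    rw [← integral_sq_gaussianReal, ← mp2.map_eq, integral_map mp2.aemeasurable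
      (Measurable.aestronglyMeasurable (by fun_prop))]
  set g : (Fin d → ℝ) × (Fin d → ℝ) → ℝ := fun ω =>
    B * ((p ^ 2 + |p * q|) * (a ⬝ᵥ ω.1) ^ 2 + (|p * q| + |q ^ 2 - c|) * (a ⬝ᵥ ω.2) ^ 2) with hg
  have ig : Integrable g (prodGaussian d) :=
    ((i1.const_mul _).add (i2.const_mul _)).const_mul B
  have hpt : ∀ ω : (Fin d → ℝ) × (Fin d → ℝ),
      |(p * (a ⬝ᵥ ω.1) + q * (a ⬝ᵥ ω.2)) ^ 2 * F ω - c * ((a ⬝ᵥ ω.2) ^ 2 * F ω)| ≤ g ω := by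
    intro ω
    set x := a ⬝ᵥ ω.1
    set y := a ⬝ᵥ ω.2
    have e1 : (p * x + q * y) ^ 2 * F ω - c * (y ^ 2 * F ω)
        = F ω * (p ^ 2 * x ^ 2 + 2 * (p * q) * (x * y) + (q ^ 2 - c) * y ^ 2) := by ring
    have e2 : |p ^ 2 * x ^ 2 + 2 * (p * q) * (x * y) + (q ^ 2 - c) * y ^ 2|
        ≤ (p ^ 2 + |p * q|) * x ^ 2 + (|p * q| + |q ^ 2 - c|) * y ^ 2 := by
      refine (abs_add_three _ _ _).trans ?_
      rw [abs_of_nonneg (by positivity : 0 ≤ p ^ 2 * x ^ 2), abs_mul, abs_mul 2, abs_mul (_ - _),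
        abs_of_nonneg (sq_nonneg y), abs_two, abs_mul x]
      have : 2 * (|x| * |y|) ≤ x ^ 2 + y ^ 2 := by
        nlinarith [sq_nonneg (|x| - |y|), sq_abs x, sq_abs y]
      nlinarith [mul_le_mul_of_nonneg_left this (abs_nonneg (p * q))]
    rw [e1, abs_mul, abs_of_nonneg (hF0 ω)]
    exact mul_le_mul (hFB ω) e2 (abs_nonneg _) hB
  have iy : Integrable (fun ω => (a ⬝ᵥ ω.2) ^ 2 * F ω) (prodGaussian d) := by
    refine (i2.const_mul B).mono' (Measurable.aestronglyMeasurable (by fun_prop))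
      (ae_of_all _ fun ω => ?_)
    rw [Real.norm_of_nonneg (mul_nonneg (sq_nonneg _) (hF0 ω)), mul_comm]
    exact mul_le_mul_of_nonneg_right (hFB ω) (sq_nonneg _)
  have id : Integrable (fun ω => (p * (a ⬝ᵥ ω.1) + q * (a ⬝ᵥ ω.2)) ^ 2 * F ω
      - c * ((a ⬝ᵥ ω.2) ^ 2 * F ω)) (prodGaussian d) :=
    ig.mono' (Measurable.aestronglyMeasurable (by fun_prop)) (ae_of_all _ hpt)
  have ix : Integrable (fun ω => (p * (a ⬝ᵥ ω.1) + q * (a ⬝ᵥ ω.2)) ^ 2 * F ω)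
      (prodGaussian d) := by
    refine (id.add (iy.const_mul c)).congr (ae_of_all _ fun ω => ?_)
    simp
  rw [← integral_const_mul, ← integral_sub ix (iy.const_mul c)]
  refine abs_integral_le_integral_abs.trans ((integral_mono id.abs ig hpt).trans (le_of_eq ?_))
  simp only [hg]
  rw [integral_const_mul, integral_add (i1.const_mul _) (i2.const_mul _), integral_const_mul,
    integral_const_mul, v1, v2]
  ring

variable {A Q : Matrix (Fin d) (Fin d) ℝ} {lam : Fin d → ℝ}

lemma transpose_mulVec_apply_eq_zero (hQ : Qᵀ * Q = 1)
    (hA : A = conjDiag Q (fun i => lam i ^ 2)) {q : Fin d → ℝ} {μ : ℝ}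
    (hq : A *ᵥ q = μ • q) (i : Fin d) : lam i ^ 2 * (Qᵀ *ᵥ q) i = μ * (Qᵀ *ᵥ q) i := by
  have h1 : Qᵀ *ᵥ (A *ᵥ q) = (fun i => lam i ^ 2) * (Qᵀ *ᵥ q) := by
    rw [hA, conjDiag, mulVec_mulVec, ← Matrix.mul_assoc, ← Matrix.mul_assoc, hQ, Matrix.one_mul,
      ← mulVec_mulVec]
    ext i
    simp [mulVec_diagonal]
  rw [hq, mulVec_smul] at h1
  exact (congrFun h1 i).symm

/-- The displacement along an eigenvector of `A` in spectral coordinates. -/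
lemma dotProduct_specState_sub (hQ : Qᵀ * Q = 1) (hlam : ∀ i, 0 < lam i)
    (hA : A = conjDiag Q (fun i => lam i ^ 2)) (h : ℝ) (b : Fin d → ℝ) (L : ℕ)
    {q : Fin d → ℝ} {j : Fin d} (hq : A *ᵥ q = lam j ^ 2 • q) (z w : Fin d → ℝ) :
    q ⬝ᵥ (specState A b Q lam (specStep lam h L z w) - specState A b Q lam z)
      = (slaEig lam h j ^ L - 1) / lam j * ((Qᵀ *ᵥ q) ⬝ᵥ z)
        + slaNoise lam h L j / lam j * ((Qᵀ *ᵥ q) ⬝ᵥ w) := by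
  rw [specState_sub, dotProduct_mulVec, ← mulVec_transpose]
  set a := Qᵀ *ᵥ q with ha
  simp only [dotProduct, Finset.mul_sum]
  rw [← Finset.sum_add_distrib]
  refine Finset.sum_congr rfl fun i _ => ?_
  have h1 := transpose_mulVec_apply_eq_zero hQ hA hq i
  rw [← ha] at h1
  by_cases h0 : a i = 0
  · simp [h0]
  · have h2 : lam i = lam j := by
      have := mul_right_cancel₀ h0 h1
      exact (pow_left_inj₀ (hlam i).le (hlam j).le two_ne_zero).mp this
    have h3 : slaEig lam h i = slaEig lam h j := by rw [slaEig, slaEig, h2]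
    have h4 : slaNoise lam h L i = slaNoise lam h L j := by
      simp only [slaNoise, slaSum, h2, h3]
    have := (hlam j).ne'
    rw [specStep, h4, h3, h2]
    field_simp
    ring

lemma transpose_mulVec_dotProduct_self (hQ : Qᵀ * Q = 1) {q : Fin d → ℝ} (hq : q ⬝ᵥ q = 1) :
    (Qᵀ *ᵥ q) ⬝ᵥ (Qᵀ *ᵥ q) = 1 := by
  rw [mulVec_dotProduct_mulVec_of_orthogonal
    (by rw [transpose_transpose]; exact mul_eq_one_comm.mp hQ), hq]

/-- The mean squared displacement along an eigenvector of `A`. -/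
lemma abs_integral_displacement_sub_le {h e m : ℝ} (hQ : Qᵀ * Q = 1) (hlam : ∀ i, 0 < lam i)
    (hA : A = conjDiag Q (fun i => lam i ^ 2)) (hh : 0 < h) (hi : ∀ i, h * lam i ^ 2 ≤ e)
    (he : e ≤ 1) (b : Fin d → ℝ) (L : ℕ) {φ : (Fin d → ℝ) → ℝ} (hφ : Measurable φ)
    (hm : ∀ x, m ≤ φ x) {q : Fin d → ℝ} {j : Fin d} (hq : A *ᵥ q = lam j ^ 2 • q)
    (hq1 : q ⬝ᵥ q = 1) (J : ℝ) :
    |∫ ω, (q ⬝ᵥ (specState A b Q lam (specStep lam h L ω.1 ω.2) - specState A b Q lam ω.1)) ^ 2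
          * lsAccept A b φ h L (specState A b Q lam ω.1)
            (specState A b Q lam (specStep lam h L ω.1 ω.2))
          * Real.exp (-φ (specState A b Q lam ω.1)) ∂prodGaussian d - h * (L * J)|
      ≤ h * (Real.exp (-m) * (2 * L ^ 2 * e + 2 * √(L ^ 3 * e))
        + L * |∫ ω, ((Qᵀ *ᵥ q) ⬝ᵥ ω.2) ^ 2 * lsAccept A b φ h L (specState A b Q lam ω.1)
            (specState A b Q lam (specStep lam h L ω.1 ω.2))
          * Real.exp (-φ (specState A b Q lam ω.1)) ∂prodGaussian d - J|) := by
  have ha := transpose_mulVec_dotProduct_self hQ hq1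
  set a := Qᵀ *ᵥ q
  simp only [dotProduct_specState_sub hQ hlam hA h b L hq, mul_assoc _ (lsAccept _ _ _ _ _ _ _)]
  set p := (slaEig lam h j ^ L - 1) / lam j with hp
  set r := slaNoise lam h L j / lam j with hr
  set F : (Fin d → ℝ) × (Fin d → ℝ) → ℝ := fun ω => lsAccept A b φ h L (specState A b Q lam ω.1)
    (specState A b Q lam (specStep lam h L ω.1 ω.2))
      * Real.exp (-φ (specState A b Q lam ω.1)) with hF
  have hFm : Measurable F := by
    have h1 : Measurable (specState A b Q lam) := by unfold specState; fun_prop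
    have h2 : Measurable fun ω : (Fin d → ℝ) × (Fin d → ℝ) => specStep lam h L ω.1 ω.2 := by
      unfold specStep; fun_prop
    have h3 := (measurable_lsAccept (A := A) (b := b) hφ h L).comp
      (g := fun p : (Fin d → ℝ) × (Fin d → ℝ) => lsAccept A b φ h L p.1 p.2)
      (f := fun ω : (Fin d → ℝ) × (Fin d → ℝ) => (specState A b Q lam ω.1,
        specState A b Q lam (specStep lam h L ω.1 ω.2))) (by fun_prop)
    exact h3.mul (by fun_prop)
  have hF0 : ∀ ω, 0 ≤ F ω := fun ω => mul_nonneg (lsAccept_nonneg _ _ _ _ _ _ _) (Real.exp_pos _).le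
  have hFB : ∀ ω, F ω ≤ Real.exp (-m) := fun ω =>
    (mul_le_of_le_one_left (Real.exp_pos _).le (lsAccept_le_one _ _ _ _ _ _ _)).trans
      (Real.exp_le_exp.mpr (neg_le_neg (hm _)))
  have key := abs_integral_sq_mul_sub_le ha p r (h * L) hFm hF0 hFB
  have hl := hlam j
  have hε0 : 0 ≤ h * lam j ^ 2 := by positivity
  have hε1 := (hi j).trans he
  have e0 : 0 ≤ e := hε0.trans (hi j)
  have hG := slaEig_pow_mem hh.le j hε1 L
  have hG' := one_sub_slaEig_pow_le j hε1 L
  have hp2 : p ^ 2 ≤ h * (L ^ 2 * e) := by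
    have h1 : (slaEig lam h j ^ L - 1) ^ 2 ≤ (L * (h * lam j ^ 2)) ^ 2 := by
      rw [← neg_sq, neg_sub]
      have : 0 ≤ L * (h * lam j ^ 2) := by positivity
      exact pow_le_pow_left₀ (by linarith) (by linarith) 2
    rw [hp, div_pow, div_le_iff₀ (by positivity)]
    refine h1.trans ?_
    calc ((L : ℝ) * (h * lam j ^ 2)) ^ 2 = h * (L ^ 2 * (h * lam j ^ 2)) * lam j ^ 2 := by ring
      _ ≤ _ := by gcongr; exact hi j
  have hr2 : r ^ 2 = h * slaSum lam h L j := by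
    rw [hr, div_pow, slaNoise_sq hh.le]
    field_simp
  have hs := slaSum_le hh.le j hε1 L
  have hs' := sub_slaSum_le hh.le j hε1 L
  have hrc : |r ^ 2 - h * L| ≤ h * (L ^ 2 * e) := by
    rw [hr2, ← mul_sub, abs_mul, abs_of_pos hh, abs_sub_comm, abs_of_nonneg (sub_nonneg.mpr hs)]
    gcongr
    exact hs'.trans (by gcongr; exact hi j)
  have hpr : |p * r| ≤ h * √(L ^ 3 * e) := by
    rw [← Real.sqrt_sq hh.le, ← Real.sqrt_mul (sq_nonneg h)]
    refine Real.abs_le_sqrt ?_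
    rw [mul_pow, hr2]
    calc p ^ 2 * (h * slaSum lam h L j) ≤ h * (L ^ 2 * e) * (h * L) :=
          mul_le_mul hp2 (by gcongr) (mul_nonneg hh.le (slaSum_nonneg _ _ _ _)) (by positivity)
      _ = _ := by ring
  set I := ∫ ω, (a ⬝ᵥ ω.2) ^ 2 * F ω ∂prodGaussian d
  refine (abs_sub_le _ (h * L * I) _).trans ?_
  have e1 : |h * L * I - h * (L * J)| = h * (L * |I - J|) := by
    rw [mul_assoc, ← mul_sub, ← mul_sub, abs_mul, abs_mul, abs_of_pos hh, Nat.abs_cast]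
  rw [e1]
  refine (add_le_add_left key _).trans ?_
  have := mul_le_mul_of_nonneg_left (a := Real.exp (-m)) (add_le_add (add_le_add hp2
    (mul_le_mul_of_nonneg_left hpr zero_le_two)) hrc) (Real.exp_pos _).le
  linarith

end Displacement

section Scaling

lemma sum_rpow_div_sq_le {d : ℕ} {lam : Fin d → ℝ} {c t r : ℝ} (hc : 0 < c)
    (hlam : ∀ i, c ≤ lam i) (ht : t ≤ r) :
    ∑ i, lam i ^ (4 * t) / lam i ^ 2
      ≤ c ^ (4 * t - 2 - (4 * r - 1)) * ∑ i, lam i ^ (4 * r - 1) := by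
  rw [Finset.mul_sum]
  refine Finset.sum_le_sum fun i _ => ?_
  have h0 : 0 < lam i := hc.trans_le (hlam i)
  have h1 : lam i ^ (4 * t) / lam i ^ 2
      = lam i ^ (4 * t - 2 - (4 * r - 1)) * lam i ^ (4 * r - 1) := by
    rw [← Real.rpow_add h0, sub_add_cancel, Real.rpow_sub h0, Real.rpow_ofNat]
  rw [h1]
  gcongr ?_ * _
  exact Real.rpow_le_rpow_of_nonpos hc (hlam i) (by linarith)

lemma tendsto_zero_of_truncation_bound {X e : ℕ → ℝ} {B₁ B₂ : ℝ} (hX : ∀ d, 0 ≤ X d)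
    (he : Tendsto e atTop (𝓝 0))
    (h : ∀ r : ℝ, 0 < r → ∃ K : ℝ, ∀ᶠ d in atTop, X d ≤ B₁ / r ^ 2 + K * √(B₂ * e d)) :
    Tendsto X atTop (𝓝 0) := by
  refine Metric.tendsto_nhds.mpr fun η hη => ?_
  have h1 : Tendsto (fun r : ℝ => B₁ / r ^ 2) atTop (𝓝 0) :=
    tendsto_const_nhds.div_atTop (tendsto_pow_atTop two_ne_zero)
  obtain ⟨r, hr, hr0⟩ := ((h1.eventually_lt_const (half_pos hη)).and (eventually_gt_atTop 0)).exists
  obtain ⟨K, hK⟩ := h r hr0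
  have h2 : Tendsto (fun d => K * √(B₂ * e d)) atTop (𝓝 0) := by
    simpa using ((he.const_mul B₂).sqrt).const_mul K
  filter_upwards [hK, h2.eventually_lt_const (half_pos hη)] with d hd hd2
  rw [Real.dist_eq, sub_zero, abs_of_nonneg (hX d)]
  linarith

lemma slaStep_mul_sq_le {d : ℕ} {l C κ x : ℝ} (hκ : 0 ≤ κ) (hx : 0 ≤ x) (i : Fin d)
    (hxC : x ≤ C * ((i : ℕ) + 1 : ℝ) ^ κ) :
    l ^ 2 * (d : ℝ) ^ (-(1 / 3 : ℝ) - 2 * κ) * x ^ 2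
      ≤ l ^ 2 * C ^ 2 * (d : ℝ) ^ (-(1 / 3 : ℝ)) := by
  have hd : (0 : ℝ) < d := by exact_mod_cast i.pos
  have h1 : x ^ 2 ≤ C ^ 2 * (d : ℝ) ^ (2 * κ) := by
    have h2 : (((i : ℕ) + 1 : ℝ) ^ κ) ^ 2 ≤ (d : ℝ) ^ (2 * κ) := by
      rw [mul_comm 2 κ, Real.rpow_mul hd.le, Real.rpow_two]
      gcongr
      exact_mod_cast i.isLt
    refine (pow_le_pow_left₀ hx hxC 2).trans ?_
    rw [mul_pow]
    gcongr
  calc l ^ 2 * (d : ℝ) ^ (-(1 / 3 : ℝ) - 2 * κ) * x ^ 2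
      ≤ l ^ 2 * (d : ℝ) ^ (-(1 / 3 : ℝ) - 2 * κ) * (C ^ 2 * (d : ℝ) ^ (2 * κ)) := by gcongr
    _ = l ^ 2 * C ^ 2 * ((d : ℝ) ^ (-(1 / 3 : ℝ) - 2 * κ) * (d : ℝ) ^ (2 * κ)) := by ring
    _ = _ := by rw [← Real.rpow_add hd, sub_add_cancel]

lemma sum_slaStep_mul_sq_pow_three {d : ℕ} (lam : Fin d → ℝ) (l κ : ℝ) :
    ∑ i, (l ^ 2 * (d : ℝ) ^ (-(1 / 3 : ℝ) - 2 * κ) * lam i ^ 2) ^ 3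
      = l ^ 6 * ((d : ℝ) ^ (-(1 : ℝ) - 6 * κ) * ∑ i, lam i ^ 6) := by
  have h1 : ((d : ℝ) ^ (-(1 / 3 : ℝ) - 2 * κ)) ^ 3 = (d : ℝ) ^ (-(1 : ℝ) - 6 * κ) := by
    rw [← Real.rpow_mul_natCast (Nat.cast_nonneg d)]
    congr 1
    push_cast
    ring
  rw [Finset.mul_sum, Finset.mul_sum, ← h1]
  exact Finset.sum_congr rfl fun i _ => by ring

lemma sqrt_mul_pow_six {l : ℝ} (hl : 0 ≤ l) (L τ : ℝ) :
    √(L * (l ^ 6 * τ)) = l ^ 3 * √(L * τ) := by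
  rw [show L * (l ^ 6 * τ) = (l ^ 3) ^ 2 * (L * τ) by ring, Real.sqrt_mul (sq_nonneg _),
    Real.sqrt_sq (pow_nonneg hl 3)]

lemma isLittleO_of_abs_le_mul {f h g : ℕ → ℝ} (hg : Tendsto g atTop (𝓝 0))
    (h0 : ∀ᶠ d in atTop, 0 ≤ h d) (hf : ∀ᶠ d in atTop, |f d| ≤ h d * g d) : f =o[atTop] h := by
  have h1 : (fun d => h d * g d) =o[atTop] h := by
    simpa using (isBigO_refl h atTop).mul_isLittleO ((isLittleO_one_iff ℝ).mpr hg)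
  refine IsBigO.trans_isLittleO (IsBigO.of_bound 1 ?_) h1
  filter_upwards [h0, hf] with d hd hfd
  rw [one_mul, Real.norm_eq_abs]
  exact hfd.trans (le_abs_self _)

lemma integral_xeq_eq {d : ℕ} {A Q R CL : Matrix (Fin d) (Fin d) ℝ} {lam : Fin d → ℝ} {h : ℝ}
    (hQ : Qᵀ * Q = 1) (hlam : ∀ i, 0 < lam i) (hA : A = conjDiag Q (fun i => lam i ^ 2))
    (hh : 0 < h) (b : Fin d → ℝ) (L : ℕ) (hR : R * Rᵀ = A⁻¹) (hCL : CL * CLᵀ = lsCov A h L)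
    {f : (Fin d → ℝ) → ℝ} (hf : Measurable f) :
    ∫ z, f (specState A b Q lam z) ∂_root_.stdGaussian d
      = ∫ z, f (xeq A b R z) ∂_root_.stdGaussian d := by
  have key := integral_xeq_ylstep hQ hlam hA hh b L hR hCL
    (H := fun x _ => f x) (by exact hf.comp measurable_fst)
  have h1 : Measurable (xeq A b R) := by unfold xeq; fun_prop
  have h2 : Measurable (specState A b Q lam) := by unfold specState; fun_prop
  have hfst : ∀ g : (Fin d → ℝ) → ℝ, Measurable g →
      ∫ ω, g ω.1 ∂prodGaussian d = ∫ z, g z ∂_root_.stdGaussian d := by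
    intro g hg
    have mp : MeasurePreserving Prod.fst (prodGaussian d) (_root_.stdGaussian d) :=
      measurePreserving_fst
    rw [← mp.map_eq, integral_map mp.aemeasurable hg.aestronglyMeasurable]
  exact (hfst _ (hf.comp h2)).symm.trans (key.symm.trans (hfst _ (hf.comp h1)))

end Scaling

/-- Theorem: optimal scaling of `L`-step SLA. Under Assumptions 1
and 2 on `φ_d` and eigenvalue growth `c iᵏ ≤ λ_i ≤ C iᵏ`, with `h = l²d^{-1/3-2κ}`,
`L`-step SLA in equilibrium satisfies `E[α(x,y)] → 2Φ(-l³√(Lτ)/8)` and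
`E[(q_iᵀ(x'-x))²] = 2LhΦ(-l³√(Lτ)/8) + o(h)` as `d → ∞`, with
`τ = lim d^{-1-6κ} Σᵢ λ_i⁶`. -/
theorem lstep_sla_optimal_scaling
    (A : ∀ d : ℕ, Matrix (Fin d) (Fin d) ℝ)
    (b : ∀ d : ℕ, Fin d → ℝ)
    (Q R CL : ∀ d : ℕ, Matrix (Fin d) (Fin d) ℝ)
    (lam : ∀ d : ℕ, Fin d → ℝ)
    (φ : ∀ d : ℕ, (Fin d → ℝ) → ℝ)
    (L : ℕ) (hL : 0 < L)
    (hA : ∀ d, (A d).PosDef)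
    (hQ : ∀ d, (Q d)ᵀ * Q d = 1)
    (hdA : ∀ d, ((Q d)ᵀ * A d * Q d).IsDiag)
    (hlam : ∀ d i, 0 < lam d i ∧ lam d i ^ 2 = ((Q d)ᵀ * A d * Q d) i i)
    (hR : ∀ d, R d * (R d)ᵀ = (A d)⁻¹)
    (hφmeas : ∀ d, Measurable (φ d))
    (hnorm : ∀ d, ∫ ξ, Real.exp (-(φ d (xeq (A d) (b d) (R d) ξ))) ∂stdGaussian d = 1)
    -- spectral growth: c iᵏ ≤ λ_i ≤ C iᵏ
    (c C κ : ℝ) (hc : 0 < c) (hC : 0 < C) (hκ : 0 ≤ κ)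
    (hbound : ∀ d (i : Fin d),
      c * ((i : ℕ) + 1 : ℝ) ^ κ ≤ lam d i ∧ lam d i ≤ C * ((i : ℕ) + 1 : ℝ) ^ κ)
    -- Assumption 1
    (m s s' s'' Cc pp : ℝ) (hCc : 0 < Cc) (hpp : 0 < pp)
    (δfun : ℝ → ℝ → ℝ) (hδnn : ∀ a cc, 0 ≤ δfun a cc)
    (hδloc : ∀ Rad : ℝ, ∃ K, ∀ a cc : ℝ, |a| ≤ Rad → |cc| ≤ Rad → δfun a cc ≤ K)
    (hlower : ∀ᶠ d in atTop, ∀ x : Fin d → ℝ, m ≤ φ d x)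
    (hlip : ∀ᶠ d in atTop, ∀ x y : Fin d → ℝ,
      |φ d x - φ d y| ≤
        δfun (snorm (Q d) (lam d) s (x - (A d)⁻¹.mulVec (b d)))
             (snorm (Q d) (lam d) s (y - (A d)⁻¹.mulVec (b d)))
          * snorm (Q d) (lam d) s' (x - y))
    (hgrow : ∀ᶠ d in atTop, ∀ x : Fin d → ℝ,
      |φ d x| ≤ Cc * (1 + snorm (Q d) (lam d) s'' (x - (A d)⁻¹.mulVec (b d)) ^ pp))
    -- Assumption 2 with r = max{s, s', s''}
    (L2 : ℝ)
    (hA2 : Tendsto (fun d : ℕ => ∑ i, lam d i ^ (4 * max s (max s' s'') - 1))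
      atTop (𝓝 L2))
    -- step size h = l² d^{-1/3 - 2κ}, the square root `CL` of `Σ_L`,
    -- and τ = lim d^{-1-6κ} Σ λ_i⁶
    (l τ : ℝ) (hl : 0 < l)
    (hCL : ∀ d : ℕ, CL d * (CL d)ᵀ
      = lsCov (A d) (l ^ 2 * (d : ℝ) ^ (-(1/3 : ℝ) - 2 * κ)) L)
    (hτ : Tendsto (fun d : ℕ => (d : ℝ) ^ (-(1 : ℝ) - 6 * κ) * ∑ i, lam d i ^ 6)
      atTop (𝓝 τ))
    -- the fixed direction: a normalized eigenvector of A
    (i0 : ℕ) (qv : ∀ d : ℕ, Fin d → ℝ)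
    (hqv : ∀ d (hd : i0 < d),
      (A d).mulVec (qv d) = (lam d ⟨i0, hd⟩) ^ 2 • qv d ∧ qv d ⬝ᵥ qv d = 1) :
    Tendsto (fun d : ℕ =>
        ∫ ω, lsAccept (A d) (b d) (φ d) (l ^ 2 * (d : ℝ) ^ (-(1/3 : ℝ) - 2 * κ)) L
              (xeq (A d) (b d) (R d) ω.1)
              (ylstep (A d) (b d) (l ^ 2 * (d : ℝ) ^ (-(1/3 : ℝ) - 2 * κ)) L (CL d)
                (xeq (A d) (b d) (R d) ω.1) ω.2)
            * Real.exp (-(φ d (xeq (A d) (b d) (R d) ω.1))) ∂prodGaussian d)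
      atTop (𝓝 (2 * Phi (-(l ^ 3) * Real.sqrt ((L : ℝ) * τ) / 8))) ∧
    (fun d : ℕ =>
        (∫ ω, (qv d ⬝ᵥ (ylstep (A d) (b d) (l ^ 2 * (d : ℝ) ^ (-(1/3 : ℝ) - 2 * κ)) L
                  (CL d) (xeq (A d) (b d) (R d) ω.1) ω.2
                - xeq (A d) (b d) (R d) ω.1)) ^ 2
            * lsAccept (A d) (b d) (φ d) (l ^ 2 * (d : ℝ) ^ (-(1/3 : ℝ) - 2 * κ)) L
              (xeq (A d) (b d) (R d) ω.1)
              (ylstep (A d) (b d) (l ^ 2 * (d : ℝ) ^ (-(1/3 : ℝ) - 2 * κ)) L (CL d)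
                (xeq (A d) (b d) (R d) ω.1) ω.2)
            * Real.exp (-(φ d (xeq (A d) (b d) (R d) ω.1))) ∂prodGaussian d)
          - 2 * (L : ℝ) * (l ^ 2 * (d : ℝ) ^ (-(1/3 : ℝ) - 2 * κ))
              * Phi (-(l ^ 3) * Real.sqrt ((L : ℝ) * τ) / 8))
      =o[atTop] (fun d : ℕ => l ^ 2 * (d : ℝ) ^ (-(1/3 : ℝ) - 2 * κ)) := by
  set h : ℕ → ℝ := fun d => l ^ 2 * (d : ℝ) ^ (-(1/3 : ℝ) - 2 * κ) with hh
  set e : ℕ → ℝ := fun d => l ^ 2 * C ^ 2 * (d : ℝ) ^ (-(1 / 3 : ℝ)) with he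
  have hpos : ∀ d i, 0 < lam d i := fun d i => (hlam d i).1
  have hAQ : ∀ d, A d = conjDiag (Q d) fun i => lam d i ^ 2 := fun d =>
    eq_conjDiag (hQ d) (hdA d) (hlam d)
  have hh0 : ∀ d, 0 ≤ h d := fun d => by positivity
  have hhpos : ∀ {d}, 0 < d → 0 < h d := fun {d} hd => by
    have : (0 : ℝ) < d := by exact_mod_cast hd
    positivity
  have hi : ∀ d i, h d * lam d i ^ 2 ≤ e d := fun d i =>
    slaStep_mul_sq_le hκ (hpos d i).le i (hbound d i).2
  have he0 : Tendsto e atTop (𝓝 0) := by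
    simpa [he] using ((tendsto_rpow_neg_atTop (by norm_num : (0 : ℝ) < 1 / 3)).comp
      tendsto_natCast_atTop_atTop).const_mul (l ^ 2 * C ^ 2)
  have he1 : ∀ᶠ d in atTop, e d ≤ 1 := he0.eventually_le_const one_pos
  have hτ0 : 0 ≤ τ := ge_of_tendsto' hτ fun d =>
    mul_nonneg (by positivity) (Finset.sum_nonneg fun i _ => by have := hpos d i; positivity)
  set θ := l ^ 6 * τ with hθ
  have hθ0 : 0 ≤ θ := by positivity
  have hT : Tendsto (fun d => ∑ i, (h d * lam d i ^ 2) ^ 3) atTop (𝓝 θ) := by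
    simp only [hh, sum_slaStep_mul_sq_pow_three]
    exact hτ.const_mul _
  have hPhi : -(√((L : ℝ) * θ) / 4) / 2 = -(l ^ 3) * √((L : ℝ) * τ) / 8 := by
    rw [hθ, sqrt_mul_pow_six hl.le]
    ring
  have hclam : ∀ d i, c ≤ lam d i := fun d i =>
    (le_mul_of_one_le_right hc.le (Real.one_le_rpow (by simp) hκ)).trans (hbound d i).1
  set r := max s (max s' s'') with hr
  have hsum : ∀ t ≤ r, ∀ᶠ d in atTop, ∑ i, lam d i ^ (4 * t) / lam d i ^ 2
      ≤ c ^ (4 * t - 2 - (4 * r - 1)) * (L2 + 1) := fun t ht => by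
    filter_upwards [hA2.eventually_le_const (lt_add_one L2)] with d hd
    exact (sum_rpow_div_sq_le hc (hclam d) ht).trans (by gcongr)
  set X : ℕ → ℝ := fun d => ∫ ω, min 1 |φ d (specState (A d) (b d) (Q d) (lam d) ω.1)
    - φ d (specState (A d) (b d) (Q d) (lam d) (specStep (lam d) (h d) L ω.1 ω.2))|
      ∂prodGaussian d with hXdef
  have hX : Tendsto X atTop (𝓝 0) := by
    refine tendsto_zero_of_truncation_bound
      (B₁ := 2 * (2 + L) * (c ^ (4 * s - 2 - (4 * r - 1)) * (L2 + 1)))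
      (B₂ := 4 * L * (c ^ (4 * s' - 2 - (4 * r - 1)) * (L2 + 1)))
      (fun d => integral_nonneg fun ω => le_min zero_le_one (abs_nonneg _)) he0 fun ρ hρ => ?_
    obtain ⟨K, hK⟩ := hδloc ρ
    have hK0 : 0 ≤ K := (hδnn 0 0).trans (hK 0 0 (by simpa using hρ.le) (by simpa using hρ.le))
    refine ⟨K, ?_⟩
    filter_upwards [hlip, he1, hsum s (le_max_left _ _),
      hsum s' ((le_max_left _ _).trans (le_max_right _ _))] with d hd hed h1 h2
    refine (integral_min_one_abs_potential_sub_le (hQ d) (hpos d) (hh0 d) (hi d) hed (b d) L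
      (hφmeas d) hρ hK0 hK hd).trans ?_
    have he' : 0 ≤ e d := by positivity
    rw [mul_right_comm (4 * (L : ℝ)) _ (e d)]
    have h3 : 4 * (L : ℝ) * e d * ∑ i, lam d i ^ (4 * s') / lam d i ^ 2
        ≤ 4 * L * e d * (c ^ (4 * s' - 2 - (4 * r - 1)) * (L2 + 1)) := by gcongr
    gcongr
  have hAB : Tendsto (fun d => acceptBound m L θ (X d) (e d) (∑ i, (h d * lam d i ^ 2) ^ 3))
      atTop (𝓝 0) := tendsto_acceptBound m L hX he0 hT
  have hnorm' : ∀ {d}, 0 < d →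
      ∫ z, Real.exp (-φ d (specState (A d) (b d) (Q d) (lam d) z)) ∂_root_.stdGaussian d = 1 :=
    fun {d} hd => (integral_xeq_eq (hQ d) (hpos d) (hAQ d) (hhpos hd) (b d) L (hR d) (hCL d)
      (f := fun x => Real.exp (-φ d x)) (by have := hφmeas d; fun_prop)).trans (hnorm d)
  constructor
  · rw [tendsto_iff_dist_tendsto_zero]
    refine squeeze_zero' (Eventually.of_forall fun d => dist_nonneg) ?_ hAB
    filter_upwards [hlower, he1, eventually_gt_atTop i0] with d hm hed hd
    have hd0 : 0 < d := i0.zero_le.trans_lt hd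
    have hφ := hφmeas d
    have hacc := measurable_lsAccept (A := A d) (b := b d) hφ (h d) L
    rw [integral_xeq_ylstep (hQ d) (hpos d) (hAQ d) (hhpos hd0) (b d) L (hR d) (hCL d)
      (H := fun x y => lsAccept (A d) (b d) (φ d) (h d) L x y * Real.exp (-φ d x))
      (hacc.mul (by fun_prop)), Real.dist_eq, ← hPhi]
    have key := abs_integral_weight_lsAccept_sub_le (k := fun _ => 1) measurable_const
      (fun t => by rw [abs_one]; nlinarith [sq_nonneg t]) (hQ d) (hpos d) (hAQ d) (hhpos hd0)
      (hi d) hed (b d) hL hφ hm hθ0 (hnorm' hd0)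
      (transpose_mulVec_dotProduct_self (hQ d) (hqv d hd).2)
    simpa only [one_mul, integral_const, probReal_univ, smul_eq_mul] using key
  · have hg : Tendsto (fun d => Real.exp (-m) * (2 * L ^ 2 * e d + 2 * √(L ^ 3 * e d))
        + L * acceptBound m L θ (X d) (e d) (∑ i, (h d * lam d i ^ 2) ^ 3)) atTop (𝓝 0) := by
      simpa only [mul_zero, add_zero, Real.sqrt_zero] using (((he0.const_mul (2 * (L : ℝ) ^ 2)).add
        (((he0.const_mul ((L : ℝ) ^ 3)).sqrt).const_mul 2)).const_mul (Real.exp (-m))).add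
          (hAB.const_mul (L : ℝ))
    refine isLittleO_of_abs_le_mul hg (Eventually.of_forall hh0) ?_
    filter_upwards [hlower, he1, eventually_gt_atTop i0] with d hm hed hd
    have hd0 : 0 < d := i0.zero_le.trans_lt hd
    have hφ := hφmeas d
    have hacc := measurable_lsAccept (A := A d) (b := b d) hφ (h d) L
    rw [integral_xeq_ylstep (hQ d) (hpos d) (hAQ d) (hhpos hd0) (b d) L (hR d) (hCL d)
      (H := fun x y => (qv d ⬝ᵥ (y - x)) ^ 2 * lsAccept (A d) (b d) (φ d) (h d) L x y
        * Real.exp (-φ d x)) (Measurable.mul (Measurable.mul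
          (by unfold dotProduct; fun_prop) hacc) (by fun_prop)), ← hPhi]
    have key := abs_integral_weight_lsAccept_sub_le (k := fun t => t ^ 2) (by fun_prop)
      (fun t => by rw [abs_of_nonneg (sq_nonneg t)]; linarith) (hQ d) (hpos d) (hAQ d) (hhpos hd0)
      (hi d) hed (b d) hL hφ hm hθ0 (hnorm' hd0)
      (transpose_mulVec_dotProduct_self (hQ d) (hqv d hd).2)
    rw [integral_sq_gaussianReal, one_mul] at key
    have hdis := abs_integral_displacement_sub_le (hQ d) (hpos d) (hAQ d) (hhpos hd0) (hi d) hed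
      (b d) L hφ hm (hqv d hd).1 (hqv d hd).2 (2 * Phi (-(√((L : ℝ) * θ) / 4) / 2))
    have hcomm : h d * (L * (2 * Phi (-(√((L : ℝ) * θ) / 4) / 2)))
        = 2 * L * h d * Phi (-(√((L : ℝ) * θ) / 4) / 2) := by ring
    rw [hcomm] at hdis
    refine hdis.trans ?_
    have := hh0 d
    gcongr
end

section
/- Let A, V ∈ ℝ^{d×d} be symmetric positive definite, h > 0 and L ∈ ℕ, and let K ∈ ℝ^{2d×2d} be the block matrix with blocks K₁₁ = I − (h²/2)VA, K₁₂ = hV, K₂₁ = −hA + (h³/4)AVA, K₂₂ = I − (h²/2)AV. Write (K^L)₁₁ and (K^L)₁₂ for the upper-left and upper-right d×d blocks of K^L, set G = (K^L)₁₁ and Σ = (K^L)₁₂ V^{-1} (K^L)₁₂^T, and assume (K^L)₁₂ and I + G are invertible. Then GΣ is symmetric, and the matrices M = Σ^{-1}(I + G), N = Σ^{-1}(I + G)G and 𝒜 = Σ^{-1}(I − G²) satisfy M − N = 𝒜, M^{-1}N = G and M^{-1}(M^T + N)M^{-T} = Σ; that is, the L-step leap-frog Hybrid Monte Carlo proposal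 for target N(A^{-1}b, A^{-1}) with mass matrix V corresponds to this matrix splitting. -/
open Matrix

/-- If `X * V = V * Xᵀ`, the same relation holds for every polynomial in `X`. -/
lemma aeval_mul_eq_mul_transpose {n R : Type*} [Fintype n] [DecidableEq n] [CommRing R]
    {X V : Matrix n n R} (hX : X * V = V * Xᵀ) (p : Polynomial R) :
    Polynomial.aeval X p * V = V * (Polynomial.aeval X p)ᵀ := by
  induction p using Polynomial.induction_on' with
  | add p q hp hq => simp only [map_add, add_mul, transpose_add, mul_add, hp, hq]
  | monomial k a =>
    have hk : SemiconjBy V (Xᵀ ^ k) (X ^ k) := SemiconjBy.pow_right hX.symm k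
    simp only [Polynomial.aeval_monomial, ← Algebra.smul_def, transpose_smul, transpose_pow,
      smul_mul_assoc, mul_smul_comm, hk.eq]

/-- The first block row of a power of the leap-frog matrix consists of a polynomial in `V * A`
and a polynomial in `V * A` times `V`. -/
lemma leapfrog_pow_first_row {n : Type*} [Fintype n] [DecidableEq n] (A V : Matrix n n ℝ)
    (h : ℝ) (L : ℕ) :
    ∃ p q : Polynomial ℝ, ∃ C D : Matrix n n ℝ,
      (fromBlocks (1 - (h ^ 2 / 2) • (V * A)) (h • V)
        ((-h) • A + (h ^ 3 / 4) • (A * V * A)) (1 - (h ^ 2 / 2) • (A * V))) ^ L =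
      fromBlocks (Polynomial.aeval (V * A) p) (Polynomial.aeval (V * A) q * V) C D := by
  induction L with
  | zero => exact ⟨1, 0, 0, 1, by simp [fromBlocks_one]⟩
  | succ L ih =>
    obtain ⟨p, q, C, D, hK⟩ := ih
    rw [pow_succ, hK, fromBlocks_multiply]
    refine ⟨p * (1 - (h ^ 2 / 2) • Polynomial.X) +
        q * ((-h) • Polynomial.X + (h ^ 3 / 4) • Polynomial.X ^ 2),
      p * (h • 1) + q * (1 - (h ^ 2 / 2) • Polynomial.X),
      C * (1 - (h ^ 2 / 2) • (V * A)) + D * ((-h) • A + (h ^ 3 / 4) • (A * V * A)),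
      C * (h • V) + D * (1 - (h ^ 2 / 2) • (A * V)), ?_⟩
    congr 1
    · simp [mul_add, pow_two, Matrix.mul_assoc]
    · simp [mul_sub, sub_mul, add_mul, Matrix.mul_assoc]

/-- The matrix splitting determined by an iteration matrix `G` and a symmetric noise
covariance `S` for which `G * S` is symmetric. -/
lemma splitting_of_isSymm_mul {n R : Type*} [Fintype n] [DecidableEq n] [CommRing R]
    {G S : Matrix n n R} (hS : IsUnit S) (hG : IsUnit (1 + G)) (hSs : S.IsSymm)
    (hGS : (G * S).IsSymm) :
    S⁻¹ * (1 + G) - S⁻¹ * (1 + G) * G = S⁻¹ * (1 - G ^ 2) ∧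
      (S⁻¹ * (1 + G))⁻¹ * (S⁻¹ * (1 + G) * G) = G ∧
      (S⁻¹ * (1 + G))⁻¹ * ((S⁻¹ * (1 + G))ᵀ + S⁻¹ * (1 + G) * G) *
          ((S⁻¹ * (1 + G))⁻¹)ᵀ = S := by
  have hSd := (isUnit_iff_isUnit_det S).mp hS
  have hGd := (isUnit_iff_isUnit_det _).mp hG
  have hMd : IsUnit (S⁻¹ * (1 + G)).det := by
    rw [det_mul]
    exact (isUnit_nonsing_inv_det S hSd).mul hGd
  have hcomm : S * Gᵀ = G * S := by
    have := hGS.eq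
    rwa [transpose_mul, hSs.eq] at this
  have hGt : Gᵀ * S⁻¹ = S⁻¹ * G := by
    calc Gᵀ * S⁻¹ = S⁻¹ * (S * Gᵀ) * S⁻¹ := by rw [nonsing_inv_mul_cancel_left _ _ hSd]
      _ = S⁻¹ * G := by rw [hcomm, ← Matrix.mul_assoc, mul_nonsing_inv_cancel_right _ _ hSd]
  have hM : (S⁻¹ * (1 + G))ᵀ = S⁻¹ * (1 + G) := by
    rw [transpose_mul, transpose_nonsing_inv, hSs.eq, transpose_add, transpose_one, add_mul,
      hGt, mul_add, one_mul, mul_one]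
  refine ⟨by noncomm_ring, nonsing_inv_mul_cancel_left _ _ hMd, ?_⟩
  rw [transpose_nonsing_inv, hM, mul_add, nonsing_inv_mul _ hMd,
    nonsing_inv_mul_cancel_left _ _ hMd, Matrix.mul_inv_rev, nonsing_inv_nonsing_inv _ hSd,
    mul_nonsing_inv_cancel_left _ _ hGd]

/-- Theorem: matrix splitting for HMC. Let `K` be the one-step
leap-frog matrix for the Hamiltonian `H(q,p) = ½pᵀVp + ½qᵀAq - bᵀq`. With
`G = (K^L)₁₁` and `Σ = (K^L)₁₂ V⁻¹ (K^L)₁₂ᵀ`, the matrix `GΣ` is symmetric, and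
`M = Σ⁻¹(I+G)`, `N = Σ⁻¹(I+G)G`, `𝒜 = Σ⁻¹(I-G²)` form the matrix splitting
corresponding to the `L`-step leap-frog HMC proposal. -/
theorem hmc_matrix_splitting {d : ℕ} (A V : Matrix (Fin d) (Fin d) ℝ)
    (h : ℝ) (L : ℕ) (hA : A.PosDef) (hV : V.PosDef) (hh : 0 < h) :
    let K : Matrix (Fin d ⊕ Fin d) (Fin d ⊕ Fin d) ℝ :=
      fromBlocks (1 - (h ^ 2 / 2) • (V * A)) (h • V)
        ((-h) • A + (h ^ 3 / 4) • (A * V * A)) (1 - (h ^ 2 / 2) • (A * V))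
    let G := (K ^ L).toBlocks₁₁
    let S := (K ^ L).toBlocks₁₂ * V⁻¹ * ((K ^ L).toBlocks₁₂)ᵀ
    IsUnit (K ^ L).toBlocks₁₂ → IsUnit (1 + G) →
    ((G * S).IsSymm ∧
      S⁻¹ * (1 + G) - S⁻¹ * (1 + G) * G = S⁻¹ * (1 - G ^ 2) ∧
      (S⁻¹ * (1 + G))⁻¹ * (S⁻¹ * (1 + G) * G) = G ∧
      (S⁻¹ * (1 + G))⁻¹ * ((S⁻¹ * (1 + G))ᵀ + S⁻¹ * (1 + G) * G) *
          ((S⁻¹ * (1 + G))⁻¹)ᵀ = S) := by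
  intro K G S hB hG
  have hAt : Aᵀ = A := by simpa using hA.isHermitian.eq
  have hVt : Vᵀ = V := by simpa using hV.isHermitian.eq
  have hVd : IsUnit V.det := (isUnit_iff_isUnit_det V).mp hV.isUnit
  have hSs : S.IsSymm := by
    simp only [S, IsSymm, transpose_mul, transpose_transpose, transpose_nonsing_inv, hVt,
      Matrix.mul_assoc]
  have hS : IsUnit S := by
    refine (hB.mul ?_).mul ((isUnit_iff_isUnit_det _).mpr ?_)
    · exact isUnit_nonsing_inv_iff.mpr hV.isUnit
    · rw [det_transpose]
      exact (isUnit_iff_isUnit_det _).mp hB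
  have hGS : (G * S).IsSymm := by
    obtain ⟨p, q, C, D, hK⟩ := leapfrog_pow_first_row A V h L
    have hX : V * A * V = V * (V * A)ᵀ := by rw [transpose_mul, hAt, hVt, Matrix.mul_assoc]
    have hGeq : G = Polynomial.aeval (V * A) p := by
      simp only [G, K, hK, toBlocks_fromBlocks₁₁]
    have hSeq : S = Polynomial.aeval (V * A) (q * q) * V := by
      simp only [S, K, hK, toBlocks_fromBlocks₁₂]
      rw [mul_nonsing_inv_cancel_right _ _ hVd, transpose_mul, hVt,
        ← aeval_mul_eq_mul_transpose hX, map_mul, Matrix.mul_assoc]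
    rw [hGeq, hSeq, ← Matrix.mul_assoc, ← map_mul, IsSymm, transpose_mul, hVt,
      aeval_mul_eq_mul_transpose hX]
  exact ⟨hGS, splitting_of_isSymm_mul hS hG hSs hGS⟩
end

section
/- Let A, V ∈ ℝ^{d×d} be symmetric positive definite, b ∈ ℝ^d, h > 0 and L ∈ ℕ, and let K and J be the 2d×2d block matrices K = [[I − (h²/2)VA, hV], [−hA + (h³/4)AVA, I − (h²/2)AV]] and J = [[2I, hV], [−(h/2)A, 2I − (h²/2)AV]], with I − K invertible and S = (I − K)^{-1}(I − K^L). Then (I − K)(A^{-1}b, 0)^T = J(0, (h/2)b)^T, and consequently (I − (K^L)₁₁) A^{-1} b = (S J (0, (h/2)b)^T)₁, where (·)₁ denotes the first d entries; equivalently, the matrix splitting associated with the HMC proposal satisfies 𝒜^{-1}β = A^{-1}b, i.e. the mean of the HMC proposal limit distribution equals the target mean. -/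
open Matrix

/-- Summing the geometric series `(1 - K)⁻¹ (1 - K ^ L)` against `1 - K` gives `1 - K ^ L`. -/
theorem Matrix.inv_one_sub_mul_one_sub_pow_mul_one_sub {n R : Type*} [Fintype n] [DecidableEq n]
    [CommRing R] (K : Matrix n n R) (L : ℕ) (hK : IsUnit (1 - K)) :
    (1 - K)⁻¹ * (1 - K ^ L) * (1 - K) = 1 - K ^ L := by
  have hcomm : Commute (1 - K ^ L) (1 - K) :=
    (Commute.one_left _).sub_left
      ((Commute.one_right _).sub_right ((Commute.refl K).pow_left L))
  rw [Matrix.mul_assoc, hcomm.eq,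
    Matrix.nonsing_inv_mul_cancel_left _ _ ((Matrix.isUnit_iff_isUnit_det _).mp hK)]

/-- Corollary: the mean of the HMC proposal limit distribution equals
the target mean. With `K`, `J` the leap-frog block matrices and `S = (I-K)⁻¹(I-K^L)`,
one has `(I-K)(A⁻¹b, 0)ᵀ = J(0, (h/2)b)ᵀ` and hence
`(I - (K^L)₁₁) A⁻¹ b = (S J (0, (h/2)b)ᵀ)₁`. -/
theorem hmc_limit_mean_eq_target_mean {d : ℕ} (A V : Matrix (Fin d) (Fin d) ℝ)
    (b : Fin d → ℝ) (h : ℝ) (L : ℕ) (hA : A.PosDef) (hV : V.PosDef) (hh : 0 < h) :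
    let K : Matrix (Fin d ⊕ Fin d) (Fin d ⊕ Fin d) ℝ :=
      fromBlocks (1 - (h ^ 2 / 2) • (V * A)) (h • V)
        ((-h) • A + (h ^ 3 / 4) • (A * V * A)) (1 - (h ^ 2 / 2) • (A * V))
    let J : Matrix (Fin d ⊕ Fin d) (Fin d ⊕ Fin d) ℝ :=
      fromBlocks (2 • (1 : Matrix (Fin d) (Fin d) ℝ)) (h • V)
        ((-(h / 2)) • A) (2 • (1 : Matrix (Fin d) (Fin d) ℝ) - (h ^ 2 / 2) • (A * V))
    let S := (1 - K)⁻¹ * (1 - K ^ L)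
    IsUnit (1 - K) →
    ((1 - K).mulVec (Sum.elim (A⁻¹.mulVec b) 0) = J.mulVec (Sum.elim 0 ((h / 2) • b)) ∧
      (1 - (K ^ L).toBlocks₁₁).mulVec (A⁻¹.mulVec b)
        = fun i : Fin d => (S * J).mulVec (Sum.elim 0 ((h / 2) • b)) (Sum.inl i)) := by
  intro K J S hK
  have hAb : A *ᵥ (A⁻¹ *ᵥ b) = b := by
    rw [mulVec_mulVec, mul_nonsing_inv _ ((isUnit_iff_isUnit_det A).mp hA.isUnit), one_mulVec]
  have hfix : (1 - K) *ᵥ Sum.elim (A⁻¹ *ᵥ b) 0 = J *ᵥ Sum.elim 0 ((h / 2) • b) := by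
    simp only [K, J, sub_mulVec, one_mulVec, fromBlocks_mulVec, Sum.elim_comp_inl,
      Sum.elim_comp_inr, mulVec_zero, add_zero, zero_add, add_mulVec, smul_mulVec,
      ← mulVec_mulVec, hAb, mulVec_smul]
    ext (i | i) <;> simp <;> ring
  refine ⟨hfix, ?_⟩
  have hSJ : (S * J) *ᵥ Sum.elim 0 ((h / 2) • b) = (1 - K ^ L) *ᵥ Sum.elim (A⁻¹ *ᵥ b) 0 := by
    rw [← mulVec_mulVec, ← hfix, mulVec_mulVec,
      inv_one_sub_mul_one_sub_pow_mul_one_sub K L hK]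
  rw [hSJ]
  ext i
  simp [mulVec, dotProduct, toBlocks₁₁, one_apply]
end

section
/- Let A, V ∈ ℝ^{d×d} be symmetric positive definite, h > 0, L ∈ ℕ, and let λ_1², …, λ_d² be the eigenvalues of B = V^{1/2} A V^{1/2} (equivalently, of VA). Assume 0 < h² λ_i² < 4 for all i. Then the upper-left d×d block (K^L)₁₁ of the L-th power of the block matrix K = [[I − (h²/2)VA, hV], [−hA + (h³/4)AVA, I − (h²/2)AV]] has eigenvalues cos(L θ_i), i = 1,…,d, where θ_i = −arccos(1 − (h²/2)λ_i²). -/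
open Matrix Polynomial

namespace Matrix

variable {n : Type*} [Fintype n] [DecidableEq n] {R : Type*} [CommRing R]

/-- A matrix that an invertible `P` intertwines with a diagonal matrix has the diagonal entries
as its eigenvalues. -/
theorem charpoly_eq_prod_of_mul_eq_mul_diagonal {G P : Matrix n n R} {c : n → R}
    (hP : IsUnit P) (hG : G * P = P * diagonal c) :
    G.charpoly = ∏ i, (X - C (c i)) := by
  obtain ⟨u, rfl⟩ := hP
  have hconj : G = (u : Matrix n n R) * diagonal c * (u⁻¹ : (Matrix n n R)ˣ) := by
    rw [← hG, Matrix.mul_assoc, Units.mul_inv, Matrix.mul_one]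
  rw [hconj, coe_units_inv, charpoly_units_conj, charpoly_diagonal]

end Matrix

/-- The leap-frog matrix satisfies the Chebyshev recurrence, read off in its upper-left block. -/
theorem leapfrog_pow_add_two_toBlocks₁₁ {n : Type*} [Fintype n] [DecidableEq n]
    (A V : Matrix n n ℝ) (h : ℝ) (m : ℕ) :
    let K : Matrix (n ⊕ n) (n ⊕ n) ℝ :=
      fromBlocks (1 - (h ^ 2 / 2) • (V * A)) (h • V)
        ((-h) • A + (h ^ 3 / 4) • (A * V * A)) (1 - (h ^ 2 / 2) • (A * V))
    (K ^ (m + 2)).toBlocks₁₁ =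
      (2 : ℝ) • ((1 - (h ^ 2 / 2) • (V * A)) * (K ^ (m + 1)).toBlocks₁₁)
        - (K ^ m).toBlocks₁₁ := by
  intro K
  let D : Matrix (n ⊕ n) (n ⊕ n) ℝ :=
    fromBlocks (1 - (h ^ 2 / 2) • (V * A)) 0 0 (1 - (h ^ 2 / 2) • (A * V))
  have hsq : K * K = (2 : ℝ) • (D * K) - 1 := by
    rw [← fromBlocks_one]
    simp only [K, D, fromBlocks_multiply, fromBlocks_smul, sub_eq_add_neg, fromBlocks_neg,
      fromBlocks_add, Matrix.zero_mul, add_zero, zero_add]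
    congr 1 <;>
      simp only [Matrix.mul_add, Matrix.add_mul, Matrix.mul_neg, Matrix.neg_mul, Matrix.mul_smul,
        Matrix.smul_mul, Matrix.mul_one, Matrix.one_mul, Matrix.mul_assoc] <;>
      module
  have hrec : K ^ (m + 2) = (2 : ℝ) • (D * K ^ (m + 1)) - K ^ m := by
    rw [add_comm m 2, pow_add, pow_two, hsq, pow_succ', sub_mul, one_mul, smul_mul_assoc,
      mul_assoc]
  rw [hrec]
  ext i j
  simp [toBlocks₁₁, Matrix.mul_apply, Fintype.sum_sum_type, D, fromBlocks]

/-- Theorem: eigenvalues of the HMC iteration matrix. If `λ_i²` are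
the eigenvalues of `B = V^{1/2} A V^{1/2}` (equivalently of `VA`) and `0 < h²λ_i² < 4`,
then the iteration matrix `(K^L)₁₁` of the `L`-step leap-frog HMC proposal has
eigenvalues `cos(L θ_i)` with `θ_i = -arccos(1 - (h²/2)λ_i²)`; here stated as an
identity of characteristic polynomials (eigenvalues with multiplicity). -/
theorem hmc_iteration_matrix_eigenvalues {d : ℕ}
    (A V Vh Q : Matrix (Fin d) (Fin d) ℝ) (lam : Fin d → ℝ) (h : ℝ) (L : ℕ)
    (hA : A.PosDef) (hV : V.PosDef) (hVh : Vh.PosDef) (hVhsq : Vh * Vh = V)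
    (hQ : Qᵀ * Q = 1)
    (hdiag : Qᵀ * (Vh * A * Vh) * Q = Matrix.diagonal fun i => (lam i) ^ 2)
    (hh : 0 < h) (hsmall : ∀ i, 0 < h ^ 2 * (lam i) ^ 2 ∧ h ^ 2 * (lam i) ^ 2 < 4) :
    let K : Matrix (Fin d ⊕ Fin d) (Fin d ⊕ Fin d) ℝ :=
      fromBlocks (1 - (h ^ 2 / 2) • (V * A)) (h • V)
        ((-h) • A + (h ^ 3 / 4) • (A * V * A)) (1 - (h ^ 2 / 2) • (A * V))
    ((K ^ L).toBlocks₁₁).charpoly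
      = ∏ i : Fin d,
          (X - C (Real.cos ((L : ℝ) * (-Real.arccos (1 - h ^ 2 / 2 * (lam i) ^ 2))))) := by
  intro K
  set θ : Fin d → ℝ := fun i => -Real.arccos (1 - h ^ 2 / 2 * (lam i) ^ 2) with hθ
  have hcos (i : Fin d) : Real.cos (θ i) = 1 - h ^ 2 / 2 * (lam i) ^ 2 := by
    have := hsmall i
    rw [hθ, Real.cos_neg, Real.cos_arccos] <;> linarith
  have hQ' : Q * Qᵀ = 1 := mul_eq_one_comm.mp hQ
  have hP : IsUnit (Vh * Q) := hVh.isUnit.mul (IsUnit.of_mul_eq_one _ hQ')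
  have hVA : V * A * (Vh * Q) = Vh * Q * diagonal fun i => (lam i) ^ 2 := by
    rw [← hdiag, ← hVhsq]
    calc _ = Vh * 1 * (Vh * A * Vh) * Q := by simp only [Matrix.mul_one, Matrix.mul_assoc]
      _ = _ := by rw [← hQ']; simp only [Matrix.mul_assoc]
  have hM : (1 - (h ^ 2 / 2) • (V * A)) * (Vh * Q)
      = Vh * Q * diagonal fun i => Real.cos (θ i) := by
    have hdiff : (diagonal fun i => Real.cos (θ i))
        = 1 - (h ^ 2 / 2) • diagonal fun i => (lam i) ^ 2 := by
      rw [← diagonal_one, ← diagonal_smul, diagonal_sub]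
      simp [hcos]
    rw [hdiff, Matrix.sub_mul, Matrix.mul_sub, Matrix.smul_mul, hVA, Matrix.mul_smul,
      Matrix.one_mul, Matrix.mul_one]
  have hpow (m : ℕ) : (K ^ m).toBlocks₁₁ * (Vh * Q)
      = Vh * Q * diagonal fun i => Real.cos (m * θ i) := by
    induction m using Nat.twoStepInduction with
    | zero => simp [← fromBlocks_one]
    | one => simpa [K] using hM
    | more m ih₀ ih₁ =>
      rw [leapfrog_pow_add_two_toBlocks₁₁, Matrix.sub_mul, Matrix.smul_mul, Matrix.mul_assoc,
        ih₀, ih₁, ← Matrix.mul_assoc, hM, Matrix.mul_assoc, diagonal_mul_diagonal,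
        ← Matrix.mul_smul, ← Matrix.mul_sub, ← diagonal_smul, diagonal_sub]
      congr 2
      ext i
      have hadd := Real.cos_add ((m + 1) * θ i) (θ i)
      have hsub := Real.cos_sub ((m + 1) * θ i) (θ i)
      rw [show (m + 1) * θ i + θ i = (m + 2) * θ i by ring] at hadd
      rw [show (m + 1) * θ i - θ i = m * θ i by ring] at hsub
      simp only [Pi.smul_apply, smul_eq_mul]
      push_cast
      linarith
  exact charpoly_eq_prod_of_mul_eq_mul_diagonal hP (hpow L)
end
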